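/- arXiv:1812.10123 — 4 statements merged into one kernel-verified Lean document; each statement's English description precedes it below -/
import Mathlib

section
/- Let k ≥ 2 be an integer, set d = 3k − 1, and let Δ = conv{ 0, e_1, …, e_{d−1}, 2(e_1 + ⋯ + e_{d−1}) + 3 e_d } ⊂ ℝ^d, where e_1, …, e_d are the standard unit vectors. Then Δ is a lattice simplex of dimension d and #(nΔ ∩ ℤ^d) = C(n+d, d) + C(n+d−k, d) + C(n+d−2k, d) for every integer n ≥ 1; that is, the h*-polynomial of Δ equals 1 + t^k + t^{2k}. -/
open scoped Pointwise

/-- The coercion of an integer point to a real point. -/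
def toReal {d : ℕ} (x : Fin d → ℤ) : Fin d → ℝ := fun i => (x i : ℝ)

/-- The number of lattice points in the `n`-th dilation of `P ⊆ ℝ^d`. -/
noncomputable def latticeCount {d : ℕ} (P : Set (Fin d → ℝ)) (n : ℕ) : ℕ :=
  Set.ncard {x : Fin d → ℤ | toReal x ∈ (n : ℝ) • P}

/-- The finite abelian group `Λ_Δ` attached to a lattice simplex with vertices `v`. -/
def Lambda {d : ℕ} (v : Fin (d + 1) → Fin d → ℤ) : Set (Fin (d + 1) → ℝ) :=
  {r | (∀ j, 0 ≤ r j ∧ r j < 1) ∧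
    (∀ i : Fin d, ∃ z : ℤ, ∑ j, r j * (v j i : ℝ) = (z : ℝ)) ∧
    (∃ z : ℤ, ∑ j, r j = (z : ℝ))}

/-- The height `ht(α) = ∑ᵢ αᵢ`. -/
def ht {m : ℕ} (α : Fin m → ℝ) : ℝ := ∑ i, α i

/-- The support `supp(α) = {i : αᵢ > 0}`. -/
def suppOf {m : ℕ} (α : Fin m → ℝ) : Set (Fin m) := {i | 0 < α i}

/-- Addition on `Λ_Δ`: coordinatewise fractional part of the sum. -/
noncomputable def fadd {m : ℕ} (α β : Fin m → ℝ) : Fin m → ℝ := fun i => Int.fract (α i + β i)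

/-- Negation on `Λ_Δ`: coordinatewise fractional part of `1 - αᵢ`. -/
noncomputable def fneg {m : ℕ} (α : Fin m → ℝ) : Fin m → ℝ := fun i => Int.fract (1 - α i)

/-- `P ⊆ ℝ^d` is a lattice polytope of dimension `d`: the convex hull of a finite
set of lattice points whose affine span is all of `ℝ^d`. -/
def IsFullDimLatticePolytope {d : ℕ} (P : Set (Fin d → ℝ)) : Prop :=
  ∃ V : Finset (Fin d → ℤ),
    P = convexHull ℝ (toReal '' (V : Set (Fin d → ℤ))) ∧ affineSpan ℝ P = ⊤

open Finset in
/-- Points of a positive dilation of the convex hull of a finite family are the nonnegative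
combinations whose total weight is the dilation factor. -/
lemma mem_smul_convexHull_range {ι E : Type*} [Fintype ι] [AddCommGroup E] [Module ℝ E]
    (p : ι → E) {t : ℝ} (htpos : 0 < t) (x : E) :
    x ∈ t • convexHull ℝ (Set.range p) ↔
      ∃ w : ι → ℝ, (∀ i, 0 ≤ w i) ∧ ∑ i, w i = t ∧ ∑ i, w i • p i = x := by
  classical
  have himage : convexHull ℝ (Set.range p) =
      Fintype.linearCombination ℝ p '' stdSimplex ℝ ι := by
    rw [← convexHull_rangle_single_eq_stdSimplex, LinearMap.image_convexHull, ← Set.range_comp]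
    congr 2
    ext i
    simp [Fintype.linearCombination_apply_single]
  rw [himage, Set.mem_smul_set]
  constructor
  · rintro ⟨_, ⟨w, ⟨hw₀, hw₁⟩, rfl⟩, rfl⟩
    refine ⟨fun i => t * w i, fun i => mul_nonneg htpos.le (hw₀ i), ?_, ?_⟩
    · rw [← mul_sum, hw₁, mul_one]
    · simp [Fintype.linearCombination_apply, smul_sum, mul_smul]
  · rintro ⟨w, hw₀, hw₁, rfl⟩
    refine ⟨_, ⟨fun i => t⁻¹ * w i,
      ⟨fun i => mul_nonneg (inv_nonneg.2 htpos.le) (hw₀ i), ?_⟩, rfl⟩, ?_⟩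
    · rw [← mul_sum, hw₁, inv_mul_cancel₀ htpos.ne']
    · simp [Fintype.linearCombination_apply, smul_sum, smul_smul, htpos.ne']

/-- The lattice point `∑ⱼ cⱼ vⱼ + r (1, …, 1)`, where `v` lists the vertices
`0, e₁, …, e_D, 2 (e₁ + ⋯ + e_D) + 3 e_{D+1}`. -/
def shiftedPoint {D : ℕ} (r : ℕ) (c : Fin (D + 2) → ℕ) : Fin (D + 1) → ℤ :=
  Fin.snoc (α := fun _ => ℤ)
    (fun i : Fin D => 2 * (c (Fin.last _) : ℤ) + c i.castSucc.succ + r)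
    (3 * (c (Fin.last _) : ℤ) + r)

@[simp]
lemma shiftedPoint_last {D : ℕ} (r : ℕ) (c : Fin (D + 2) → ℕ) :
    shiftedPoint r c (Fin.last D) = 3 * (c (Fin.last _) : ℤ) + r := by
  simp [shiftedPoint]

@[simp]
lemma shiftedPoint_castSucc {D : ℕ} (r : ℕ) (c : Fin (D + 2) → ℕ) (i : Fin D) :
    shiftedPoint r c i.castSucc = 2 * (c (Fin.last _) : ℤ) + c i.castSucc.succ + r := by
  simp [shiftedPoint]

lemma sum_univ_succ_castSucc {M : Type*} [AddCommMonoid M] {D : ℕ} (f : Fin (D + 2) → M) :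
    ∑ j, f j = f 0 + ((∑ i : Fin D, f i.castSucc.succ) + f (Fin.last _)) := by
  rw [Fin.sum_univ_succ, Fin.sum_univ_castSucc, Fin.succ_last]

open Finset in
/-- The points `shiftedPoint r c` with `∑ⱼ cⱼ + r k = n`. -/
noncomputable def shiftedPoints (D k n r : ℕ) : Finset (Fin (D + 1) → ℤ) :=
  if r * k ≤ n then
    ((univ : Finset (Fin (D + 2))).finsuppAntidiag (n - r * k)).image
      fun c : Fin (D + 2) →₀ ℕ => shiftedPoint r c
  else ∅

lemma mem_shiftedPoints {D k n r : ℕ} {x : Fin (D + 1) → ℤ} :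
    x ∈ shiftedPoints D k n r ↔
      ∃ c : Fin (D + 2) → ℕ, ∑ j, c j + r * k = n ∧ shiftedPoint r c = x := by
  unfold shiftedPoints
  split_ifs with h
  · simp only [Finset.mem_image, Finset.mem_finsuppAntidiag, Finset.subset_univ, and_true]
    constructor
    · rintro ⟨c, hc, rfl⟩
      exact ⟨c, by rw [hc]; omega, rfl⟩
    · rintro ⟨c, hc, rfl⟩
      refine ⟨Finsupp.equivFunOnFinite.symm c, ?_, rfl⟩
      rw [Finsupp.coe_equivFunOnFinite_symm]
      exact Nat.eq_sub_of_add_eq hc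
  · simp only [Finset.notMem_empty, false_iff]
    rintro ⟨c, hc, -⟩
    omega

lemma card_shiftedPoints {D k n r : ℕ} (h : r * k ≤ D + 1) :
    (shiftedPoints D k n r).card = Nat.choose (n + (D + 1) - r * k) (D + 1) := by
  unfold shiftedPoints
  split_ifs with hn
  · rw [Finset.card_image_of_injOn, Finset.card_finsuppAntidiag_nat_eq_choose, Finset.card_univ,
      Fintype.card_fin]
    · rw [← Nat.choose_symm_of_eq_add (a := n - r * k) (b := D + 1) (by omega)]
      congr 1
      omega
    · intro c hc c' hc' hcc
      have hl : c (Fin.last _) = c' (Fin.last _) := by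
        have := congrFun hcc (Fin.last _)
        simp only [shiftedPoint_last] at this
        omega
      have hm : ∀ i : Fin D, c i.castSucc.succ = c' i.castSucc.succ := by
        intro i
        have := congrFun hcc i.castSucc
        simp only [shiftedPoint_castSucc] at this
        omega
      simp only [Finset.mem_coe, Finset.mem_finsuppAntidiag, Finset.subset_univ, and_true,
        sum_univ_succ_castSucc] at hc hc'
      have h0 : c 0 = c' 0 := by
        simp only [hl, hm] at hc
        omega
      ext j
      refine Fin.cases h0 (fun j => ?_) j
      exact Fin.lastCases (by simpa using hl) hm j
  · rw [Finset.card_empty, Nat.choose_eq_zero_of_lt (by omega)]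

lemma disjoint_shiftedPoints {D k n r s : ℕ} (hr : r < 3) (hs : s < 3) (h : r ≠ s) :
    Disjoint (shiftedPoints D k n r) (shiftedPoints D k n s) := by
  rw [Finset.disjoint_left]
  intro x hx hx'
  obtain ⟨c, -, rfl⟩ := mem_shiftedPoints.1 hx
  obtain ⟨c', -, hc⟩ := mem_shiftedPoints.1 hx'
  have := congrFun hc (Fin.last _)
  simp only [shiftedPoint_last] at this
  omega

/-- For `D = 3k - 2`, the lattice points cut out by the facet inequalities of the `n`-th dilation
are those of the three shifted families. -/
lemma facet_inequalities_iff_mem_shiftedPoints {D k n : ℕ} (hD : D + 2 = 3 * k)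
    (x : Fin (D + 1) → ℤ) :
    (0 ≤ x (Fin.last _) ∧ (∀ i : Fin D, 2 * x (Fin.last _) ≤ 3 * x i.castSucc) ∧
      3 * ∑ i : Fin D, x i.castSucc + x (Fin.last _) ≤ 3 * n + 2 * D * x (Fin.last _)) ↔
    ∃ r < 3, x ∈ shiftedPoints D k n r := by
  have hD' : (D : ℤ) = 3 * k - 2 := by omega
  simp only [mem_shiftedPoints]
  constructor
  · rintro ⟨hy, hx, hs⟩
    obtain ⟨m, hm⟩ := Int.eq_ofNat_of_zero_le (a := x (Fin.last _) / 3) (by omega)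
    obtain ⟨r, hr⟩ := Int.eq_ofNat_of_zero_le (a := x (Fin.last _) % 3) (by omega)
    have hr3 : r < 3 := by omega
    have hxl : x (Fin.last _) = 3 * m + r := by omega
    have ha : ∀ i : Fin D, ∃ a : ℕ, x i.castSucc = 2 * m + a + r := fun i =>
      ⟨(x i.castSucc - 2 * m - r).toNat, by have := hx i; omega⟩
    choose a ha using ha
    have hsum : ∑ i, (a i : ℤ) + m + r * k ≤ n := by
      simp only [ha, hxl, Finset.sum_add_distrib, Finset.sum_const, Finset.card_univ,
        Fintype.card_fin, nsmul_eq_mul, hD'] at hs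
      have : 3 * (∑ i, (a i : ℤ) + m + r * k) ≤ 3 * n + r := by linarith
      omega
    have hsum' : ∑ i, a i + m + r * k ≤ n := by exact_mod_cast hsum
    refine ⟨r, hr3, Fin.cons (n - (∑ i, a i + m + r * k)) (Fin.snoc (α := fun _ => ℕ) a m), ?_, ?_⟩
    · rw [sum_univ_succ_castSucc, ← Fin.succ_last]
      simp only [Fin.cons_zero, Fin.cons_succ, Fin.snoc_castSucc, Fin.snoc_last]
      omega
    · ext j
      refine Fin.lastCases ?_ (fun i => ?_) j
      · rw [shiftedPoint_last, ← Fin.succ_last]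
        simp [hxl]
      · rw [shiftedPoint_castSucc, ← Fin.succ_last]
        simp [ha]
  · rintro ⟨r, hr, c, hc, rfl⟩
    have hc' := congrArg (Nat.cast (R := ℤ)) hc
    rw [sum_univ_succ_castSucc] at hc'
    push_cast at hc'
    simp only [shiftedPoint_last, shiftedPoint_castSucc]
    refine ⟨by omega, fun i => by omega, ?_⟩
    simp only [Finset.sum_add_distrib, Finset.sum_const, Finset.card_univ, Fintype.card_fin,
      nsmul_eq_mul, hD', ← hc']
    have : (0 : ℤ) ≤ c 0 := by positivity
    have : (0 : ℤ) ≤ r := by positivity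
    linarith

/-- for `k ≥ 2` and `d = 3k - 1`, the simplex
`conv{0, e₁, …, e_{d-1}, 2(e₁ + ⋯ + e_{d-1}) + 3 e_d}` is a lattice simplex of
dimension `d` with h*-polynomial `1 + t^k + t^{2k}`. -/
theorem stmt12 (k d : ℕ) (hk : 2 ≤ k) (hd : d = 3 * k - 1)
    (v : Fin (d + 1) → Fin d → ℤ)
    (hvdef : ∀ (jj : Fin (d + 1)) (i : Fin d),
      v jj i = if (jj : ℕ) = 0 then 0
        else if (jj : ℕ) < d then (if (i : ℕ) + 1 = (jj : ℕ) then 1 else 0)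
        else (if (i : ℕ) = d - 1 then 3 else 2)) :
    AffineIndependent ℝ (fun jj => toReal (v jj)) ∧
    ∀ n : ℕ, 1 ≤ n →
      latticeCount (convexHull ℝ (Set.range fun jj => toReal (v jj))) n =
        Nat.choose (n + d) d + Nat.choose (n + d - k) d + Nat.choose (n + d - 2 * k) d := by
  obtain ⟨D, rfl⟩ : ∃ D, d = D + 1 := ⟨3 * k - 2, by omega⟩
  have hD : D + 2 = 3 * k := by omega
  have hlast (w : Fin (D + 2) → ℝ) :
      (∑ j, w j • toReal (v j)) (Fin.last D) = 3 * w (Fin.last _) := by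
    have hmid (i : Fin D) : (D : ℕ) ≠ i := i.2.ne'
    simp [Finset.sum_apply, sum_univ_succ_castSucc, toReal, hvdef, hmid, mul_comm]
  have hcast (w : Fin (D + 2) → ℝ) (i : Fin D) :
      (∑ j, w j • toReal (v j)) i.castSucc = w i.castSucc.succ + 2 * w (Fin.last _) := by
    have hne : (i : ℕ) ≠ D := i.2.ne
    simp [Finset.sum_apply, sum_univ_succ_castSucc, toReal, hvdef, hne, mul_comm, ← Fin.ext_iff]
  constructor
  · rw [affineIndependent_iff_of_fintype]
    intro w hw hw'
    rw [Finset.weightedVSub_eq_linear_combination _ hw] at hw'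
    have hl : w (Fin.last _) = 0 := by
      have := hlast w
      rw [hw', Pi.zero_apply] at this
      linarith
    have hm (i : Fin D) : w i.castSucc.succ = 0 := by
      have := hcast w i
      rw [hw', Pi.zero_apply] at this
      linarith
    have h0 : w 0 = 0 := by simpa [sum_univ_succ_castSucc, hl, hm] using hw
    intro j
    refine Fin.cases h0 (fun j => ?_) j
    exact Fin.lastCases (by simpa using hl) hm j
  · intro n hn
    have hset : {x : Fin (D + 1) → ℤ |
        toReal x ∈ (n : ℝ) • convexHull ℝ (Set.range fun jj => toReal (v jj))} =
        ((shiftedPoints D k n 0 ∪ shiftedPoints D k n 1 ∪ shiftedPoints D k n 2 :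
          Finset (Fin (D + 1) → ℤ)) : Set (Fin (D + 1) → ℤ)) := by
      ext x
      have hthree : (∃ r < 3, x ∈ shiftedPoints D k n r) ↔
          (x ∈ shiftedPoints D k n 0 ∨ x ∈ shiftedPoints D k n 1) ∨
            x ∈ shiftedPoints D k n 2 := by
        constructor
        · rintro ⟨r, hr, hx⟩
          interval_cases r <;> tauto
        · rintro ((hx | hx) | hx)
          exacts [⟨0, by omega, hx⟩, ⟨1, by omega, hx⟩, ⟨2, by omega, hx⟩]
      rw [Set.mem_ofPred_eq, mem_smul_convexHull_range _ (by positivity), Finset.mem_coe,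
        Finset.mem_union, Finset.mem_union, ← hthree,
        ← facet_inequalities_iff_mem_shiftedPoints hD]
      constructor
      · rintro ⟨w, hw₀, hw₁, hwx⟩
        have hl : (x (Fin.last _) : ℝ) = 3 * w (Fin.last _) := by
          rw [← hlast, hwx]; rfl
        have hm (i : Fin D) :
            (x i.castSucc : ℝ) = w i.castSucc.succ + 2 * w (Fin.last _) := by
          rw [← hcast, hwx]; rfl
        refine ⟨?_, fun i => ?_, ?_⟩
        · have := hw₀ (Fin.last _)
          exact_mod_cast (by linarith : (0 : ℝ) ≤ x (Fin.last _))
        · have := hw₀ i.castSucc.succ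
          have := hm i
          exact_mod_cast (by linarith : (2 : ℝ) * x (Fin.last _) ≤ 3 * x i.castSucc)
        · rw [sum_univ_succ_castSucc] at hw₁
          have := hw₀ 0
          have hs : (∑ i : Fin D, (x i.castSucc : ℝ)) =
              ∑ i : Fin D, w i.castSucc.succ + D * (2 * w (Fin.last _)) := by
            simp [hm, Finset.sum_add_distrib]
          have : (3 : ℝ) * ∑ i : Fin D, (x i.castSucc : ℝ) + x (Fin.last _) ≤
              3 * n + 2 * D * x (Fin.last _) := by
            rw [hs, hl]
            linarith
          exact_mod_cast this
      · rintro ⟨hy, hx, hs⟩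
        have hy' : (0 : ℝ) ≤ x (Fin.last _) := by exact_mod_cast hy
        have hx' (i : Fin D) : (2 : ℝ) * x (Fin.last _) ≤ 3 * x i.castSucc := by
          exact_mod_cast hx i
        have hs' : (3 : ℝ) * ∑ i : Fin D, (x i.castSucc : ℝ) + x (Fin.last _) ≤
            3 * n + 2 * D * x (Fin.last _) := by exact_mod_cast hs
        set y : ℝ := (x (Fin.last _) : ℝ)
        set w : Fin (D + 2) → ℝ := Fin.cons
          (n - (∑ i : Fin D, ((x i.castSucc : ℝ) - 2 * y / 3) + y / 3))
          (Fin.snoc (α := fun _ => ℝ) (fun i : Fin D => (x i.castSucc : ℝ) - 2 * y / 3) (y / 3))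
          with hw
        have hw0 : w 0 = n - (∑ i : Fin D, ((x i.castSucc : ℝ) - 2 * y / 3) + y / 3) := by
          simp [hw]
        have hwm (i : Fin D) : w i.castSucc.succ = (x i.castSucc : ℝ) - 2 * y / 3 := by
          simp [hw]
        have hwl : w (Fin.last _) = y / 3 := by
          rw [hw, ← Fin.succ_last]
          simp
        refine ⟨w, fun j => ?_, ?_, ?_⟩
        · refine Fin.cases ?_ (fun j => ?_) j
          · rw [hw0, Finset.sum_sub_distrib]
            simp only [Finset.sum_const, Finset.card_univ, Fintype.card_fin, nsmul_eq_mul]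
            linarith
          · refine Fin.lastCases ?_ (fun i => ?_) j
            · rw [Fin.succ_last, hwl]
              positivity
            · rw [hwm]
              linarith [hx' i]
        · rw [sum_univ_succ_castSucc]
          simp only [hw0, hwm, hwl]
          ring
        · ext j
          refine Fin.lastCases ?_ (fun i => ?_) j
          · rw [hlast, hwl]
            simp only [toReal]
            linarith
          · rw [hcast, hwm, hwl]
            simp only [toReal]
            ring
    rw [latticeCount, hset, Set.ncard_coe_finset, Finset.card_union_of_disjoint,
      Finset.card_union_of_disjoint (disjoint_shiftedPoints _ _ _), card_shiftedPoints,
      card_shiftedPoints, card_shiftedPoints]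
    · simp
    any_goals omega
    rw [Finset.disjoint_union_left]
    exact ⟨disjoint_shiftedPoints (by omega) (by omega) (by omega),
      disjoint_shiftedPoints (by omega) (by omega) (by omega)⟩
end

section
/- Let k ≥ 2 be an integer, set d = 3k − 1, and let Δ ⊂ ℝ^d be the lattice simplex with vertices v_1 = 0, v_2 = e_1, …, v_d = e_{d−1}, v_{d+1} = 2(e_1 + ⋯ + e_{d−1}) + 3 e_d, where e_1, …, e_d are the standard unit vectors. Then every nonzero α ∈ Λ_Δ satisfies supp(α) = {1, …, d+1}; consequently, for every proper subset S ⊊ {1,…,d+1} with #S = m+1 ≥ 1, the face Δ' = conv{ v_i : i ∈ S } satisfies #(nΔ' ∩ ℤ^d) = C(n+m, m) for all integers n ≥ 1, i.e., the h*-polynomial of every proper face of Δ equals 1. -/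
open scoped Pointwise

/-- Points of the dilation of the convex hull of a finite family are the nonnegative
combinations whose weights sum to the dilation factor. -/
theorem mem_smul_convexHull_image_iff {ι E : Type*} [AddCommGroup E] [Module ℝ E]
    (S : Finset ι) (p : ι → E) {t : ℝ} (ht : 0 < t) (x : E) :
    x ∈ t • convexHull ℝ (p '' (S : Set ι)) ↔
      ∃ w : ι → ℝ, (∀ i ∈ S, 0 ≤ w i) ∧ ∑ i ∈ S, w i = t ∧ ∑ i ∈ S, w i • p i = x := by
  classical
  constructor
  · rintro ⟨y, hy, rfl⟩
    suffices h : convexHull ℝ (p '' (S : Set ι)) ⊆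
        {y | ∃ w : ι → ℝ, (∀ i ∈ S, 0 ≤ w i) ∧ ∑ i ∈ S, w i = 1 ∧ ∑ i ∈ S, w i • p i = y} by
      obtain ⟨w, hw0, hw1, rfl⟩ := h hy
      refine ⟨fun i => t * w i, fun i hi => mul_nonneg ht.le (hw0 i hi), ?_, ?_⟩
      · rw [← Finset.mul_sum, hw1, mul_one]
      · simp only [mul_smul, Finset.smul_sum]
    apply convexHull_min
    · rintro _ ⟨i, hi, rfl⟩
      have hi' : i ∈ S := hi
      refine ⟨Pi.single i 1, fun j _ => ?_, ?_, ?_⟩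
      · by_cases h : j = i
        · subst h; simp
        · simp [h]
      · simp [Pi.single_apply, hi']
      · simp [Pi.single_apply, ite_smul, hi']
    · rintro _ ⟨w, hw0, hw1, rfl⟩ _ ⟨u, hu0, hu1, rfl⟩ a b ha hb hab
      refine ⟨fun i => a * w i + b * u i, fun i hi => ?_, ?_, ?_⟩
      · exact add_nonneg (mul_nonneg ha (hw0 i hi)) (mul_nonneg hb (hu0 i hi))
      · rw [Finset.sum_add_distrib, ← Finset.mul_sum, ← Finset.mul_sum, hw1, hu1]
        linarith
      · simp only [add_smul, mul_smul, Finset.smul_sum, Finset.sum_add_distrib]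
  · rintro ⟨w, hw0, hw1, rfl⟩
    refine ⟨∑ i ∈ S, (t⁻¹ * w i) • p i, ?_, ?_⟩
    · refine (convex_convexHull ℝ _).sum_mem (fun i hi => ?_) ?_ fun i hi => ?_
      · exact mul_nonneg (inv_nonneg.2 ht.le) (hw0 i hi)
      · rw [← Finset.mul_sum, hw1, inv_mul_cancel₀ ht.ne']
      · exact subset_convexHull ℝ _ ⟨i, hi, rfl⟩
    · simp only [Finset.smul_sum, smul_smul, mul_inv_cancel_left₀ ht.ne']

/-- If `Λ` has no nonzero element supported on `S`, the face spanned by `S` is unimodular. -/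
theorem latticeCount_convexHull_image_of_Lambda {d : ℕ} (v : Fin (d + 1) → Fin d → ℤ)
    (hv : ∀ w : Fin (d + 1) → ℝ, ∑ j, w j = 0 → (∀ i, ∑ j, w j * (v j i : ℝ) = 0) → w = 0)
    (S : Finset (Fin (d + 1))) (hS : S.Nonempty)
    (hΛ : ∀ α ∈ Lambda v, (∀ j ∉ S, α j = 0) → α = 0) (n : ℕ) (hn : 1 ≤ n) :
    latticeCount (convexHull ℝ ((fun j => toReal (v j)) '' (S : Set (Fin (d + 1))))) n =
      Nat.choose (n + (S.card - 1)) (S.card - 1) := by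
  have hn0 : (0 : ℝ) < n := by exact_mod_cast hn
  have hset : {x : Fin d → ℤ | toReal x ∈
      (n : ℝ) • convexHull ℝ ((fun j => toReal (v j)) '' (S : Set (Fin (d + 1))))} =
      (fun c : Fin (d + 1) →₀ ℕ => fun i => ∑ j, (c j : ℤ) * v j i) ''
        (S.finsuppAntidiag n : Set (Fin (d + 1) →₀ ℕ)) := by
    ext x
    rw [Set.mem_ofPred_eq, mem_smul_convexHull_image_iff S _ hn0]
    constructor
    · rintro ⟨w, hw0, hw1, hwx⟩
      set u : Fin (d + 1) → ℝ := fun j => if j ∈ S then w j else 0 with hu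
      have hu0 : ∀ j, 0 ≤ u j := fun j => by
        by_cases h : j ∈ S
        · simpa [hu, h] using hw0 j h
        · simp [hu, h]
      have hu1 : ∑ j, u j = n := by simpa [hu] using hw1
      have hux : ∀ i, ∑ j, u j * (v j i : ℝ) = x i := fun i => by
        have := congrFun hwx i
        simpa [hu, ite_mul, toReal, Finset.sum_apply] using this
      have hfl : ∀ j, u j = (⌊u j⌋₊ : ℝ) := by
        have hz : (fun j => Int.fract (u j)) = 0 := by
          refine hΛ _ ⟨fun j => ⟨Int.fract_nonneg _, Int.fract_lt_one _⟩, fun i => ?_, ?_⟩ ?_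
          · refine ⟨x i - ∑ j, ⌊u j⌋ * v j i, ?_⟩
            push_cast
            rw [← hux i, ← Finset.sum_sub_distrib]
            exact Finset.sum_congr rfl fun j _ => by rw [Int.fract]; ring
          · refine ⟨n - ∑ j, ⌊u j⌋, ?_⟩
            push_cast
            rw [← hu1, ← Finset.sum_sub_distrib]
            rfl
          · intro j hj
            simp [hu, hj]
        intro j
        have h1 := congrFun hz j
        simp only [Pi.zero_apply, Int.fract] at h1
        rw [natCast_floor_eq_intCast_floor (hu0 j)]
        linarith
      refine ⟨Finsupp.equivFunOnFinite.symm fun j => ⌊u j⌋₊, ?_, ?_⟩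
      · rw [Finset.mem_coe, Finset.mem_finsuppAntidiag']
        constructor
        · rw [Finsupp.sum_fintype _ _ (by simp)]
          have : ((∑ j, ⌊u j⌋₊ : ℕ) : ℝ) = (n : ℕ) := by
            push_cast
            rw [← hu1]
            exact Finset.sum_congr rfl fun j _ => (hfl j).symm
          exact_mod_cast this
        · intro j hj
          by_contra h
          simp [hu, h] at hj
      · funext i
        have : ((∑ j, (⌊u j⌋₊ : ℤ) * v j i : ℤ) : ℝ) = x i := by
          rw [← hux i]
          push_cast
          exact Finset.sum_congr rfl fun j _ => by rw [← hfl j]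
        exact_mod_cast this
    · rintro ⟨c, hc, rfl⟩
      rw [Finset.mem_coe, Finset.mem_finsuppAntidiag] at hc
      refine ⟨fun j => (c j : ℝ), fun j _ => Nat.cast_nonneg _, by rw [← hc.1, Nat.cast_sum], ?_⟩
      funext i
      simp only [toReal, Finset.sum_apply, Pi.smul_apply, smul_eq_mul]
      push_cast
      refine Finset.sum_subset (Finset.subset_univ S) fun j _ hj => ?_
      have : c j = 0 := by
        by_contra h
        exact hj (hc.2 (Finsupp.mem_support_iff.2 h))
      simp [this]
  have hsum : ∀ c ∈ S.finsuppAntidiag n, ∑ j, (c j : ℝ) = n := fun c hc => by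
    rw [Finset.mem_finsuppAntidiag', Finsupp.sum_fintype _ _ (by simp)] at hc
    exact_mod_cast hc.1
  rw [latticeCount, hset, Set.InjOn.ncard_image, Set.ncard_coe_finset,
    Finset.card_finsuppAntidiag_nat_eq_choose]
  · have := hS.card_pos
    rw [show S.card + n - 1 = n + (S.card - 1) by omega, Nat.choose_symm_add]
  · intro c hc e he hce
    have h0 := hv (fun j => (c j : ℝ) - e j)
      (by rw [Finset.sum_sub_distrib, hsum c hc, hsum e he, sub_self]) fun i => by
        have : ((∑ j, (c j : ℤ) * v j i : ℤ) : ℝ) = ((∑ j, (e j : ℤ) * v j i : ℤ) : ℝ) :=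
          congrArg _ (congrFun hce i)
        push_cast at this
        simp only [sub_mul, Finset.sum_sub_distrib, this, sub_self]
    ext j
    have := congrFun h0 j
    simp only [Pi.zero_apply, sub_eq_zero] at this
    exact_mod_cast this

/-- for the simplex of Statement 12, every nonzero `α ∈ Λ_Δ` has full
support; consequently every proper face `conv{vᵢ : i ∈ S}` has h*-polynomial `1`. -/
theorem stmt13 (k d : ℕ) (hk : 2 ≤ k) (hd : d = 3 * k - 1)
    (v : Fin (d + 1) → Fin d → ℤ)
    (hvdef : ∀ (jj : Fin (d + 1)) (i : Fin d),
      v jj i = if (jj : ℕ) = 0 then 0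
        else if (jj : ℕ) < d then (if (i : ℕ) + 1 = (jj : ℕ) then 1 else 0)
        else (if (i : ℕ) = d - 1 then 3 else 2)) :
    (∀ α ∈ Lambda v, α ≠ 0 → suppOf α = Set.univ) ∧
    ∀ S : Finset (Fin (d + 1)), S.Nonempty → S ≠ Finset.univ →
      ∀ n : ℕ, 1 ≤ n →
        latticeCount (convexHull ℝ ((fun jj => toReal (v jj)) '' (S : Set (Fin (d + 1))))) n =
          Nat.choose (n + (S.card - 1)) (S.card - 1) := by
  have hd5 : 5 ≤ d := by omega
  have hlast : ∀ w : Fin (d + 1) → ℝ,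
      ∑ j, w j * (v j ⟨d - 1, by omega⟩ : ℝ) = 3 * w (Fin.last d) := fun w => by
    rw [Finset.sum_eq_single (Fin.last d)]
    · rw [hvdef]
      simp [show d ≠ 0 by omega, mul_comm]
    · intro j _ hj
      have hjd : (j : ℕ) < d := by
        have := Fin.val_ne_of_ne hj
        simp only [Fin.val_last] at this
        omega
      rw [hvdef]
      simp [hjd, show d - 1 + 1 ≠ (j : ℕ) by omega]
    · simp
  have hcoord : ∀ (w : Fin (d + 1) → ℝ) (j : Fin (d + 1)) (h0 : (j : ℕ) ≠ 0) (h : (j : ℕ) < d),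
      ∑ l, w l * (v l ⟨j - 1, by omega⟩ : ℝ) = w j + 2 * w (Fin.last d) := fun w j h0 h => by
    rw [Fintype.sum_eq_add j (Fin.last d) (by rintro rfl; simp at h)]
    · rw [hvdef, hvdef]
      simp [h0, h, show d ≠ 0 by omega, show (j : ℕ) - 1 + 1 = j by omega,
        show (j : ℕ) - 1 ≠ d - 1 by omega, mul_comm]
    · rintro l ⟨hlj, hl⟩
      have h1 := Fin.val_ne_of_ne hlj
      have h2 := Fin.val_ne_of_ne hl
      simp only [Fin.val_last] at h2
      rw [hvdef]
      simp [show (l : ℕ) < d by omega, show (j : ℕ) - 1 + 1 ≠ l by omega]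
  have hinj : ∀ w : Fin (d + 1) → ℝ, ∑ j, w j = 0 →
      (∀ i, ∑ j, w j * (v j i : ℝ) = 0) → w = 0 := by
    intro w hw hwv
    have hl : w (Fin.last d) = 0 := by
      have := hwv ⟨d - 1, by omega⟩
      rw [hlast] at this
      linarith
    have hne : ∀ j, j ≠ 0 → w j = 0 := fun j hj => by
      have h0 : (j : ℕ) ≠ 0 := Fin.val_ne_of_ne hj
      by_cases h : (j : ℕ) < d
      · have := hwv ⟨j - 1, by omega⟩
        rw [hcoord w j h0 h] at this
        linarith
      · rw [show j = Fin.last d from Fin.ext (by simp; omega), hl]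
    rw [Fintype.sum_eq_single 0 hne] at hw
    funext j
    by_cases hj : j = 0
    · rw [hj, hw]; rfl
    · exact hne j hj
  have heq : ∀ α ∈ Lambda v, ∀ j, α j = α (Fin.last d) := by
    rintro α ⟨hα, hαv, s, hs⟩
    obtain ⟨z, hz⟩ := hαv ⟨d - 1, by omega⟩
    rw [hlast] at hz
    have huniq : ∀ (j : Fin (d + 1)) (m : ℤ), α j - α (Fin.last d) = m →
        α j = α (Fin.last d) := fun j m hm => by
      have h1 := hα j
      have h2 := hα (Fin.last d)
      have h3 : (m : ℝ) < 1 := by linarith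
      have h4 : (-1 : ℝ) < m := by linarith
      have h5 : m < 1 := by exact_mod_cast h3
      have h6 : -1 < m := by exact_mod_cast h4
      rw [show m = 0 by omega, Int.cast_zero] at hm
      linarith
    have hne : ∀ j, j ≠ 0 → α j = α (Fin.last d) := fun j hj => by
      have h0 : (j : ℕ) ≠ 0 := Fin.val_ne_of_ne hj
      by_cases h : (j : ℕ) < d
      · obtain ⟨y, hy⟩ := hαv ⟨j - 1, by omega⟩
        rw [hcoord α j h0 h] at hy
        refine huniq j (y - z) ?_
        push_cast
        linarith
      · rw [show j = Fin.last d from Fin.ext (by simp; omega)]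
    intro j
    by_cases hj : j = 0
    · subst hj
      have hsum : α 0 + d * α (Fin.last d) = s := by
        rw [← hs, Fin.sum_univ_succ,
          Finset.sum_congr rfl fun i _ => hne (Fin.succ i) (Fin.succ_ne_zero i)]
        simp
      have hdk : (d : ℝ) = 3 * k - 1 := by
        rw [hd, Nat.cast_sub (by omega)]
        push_cast
        ring
      refine huniq 0 (s - k * z) ?_
      push_cast
      rw [← hz, ← hsum, hdk]
      ring
    · exact hne j hj
  refine ⟨fun α hα hα0 => ?_, fun S hS hSu n hn => ?_⟩
  · refine Set.eq_univ_of_forall fun j => lt_of_le_of_ne (hα.1 j).1 fun h => hα0 ?_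
    funext l
    rw [heq α hα l, ← heq α hα j, ← h]
    rfl
  · refine latticeCount_convexHull_image_of_Lambda v hinj S hS (fun α hα hαS => ?_) n hn
    obtain ⟨j, hj⟩ : ∃ j, j ∉ S := by
      by_contra! h
      exact hSu (Finset.eq_univ_iff_forall.2 h)
    funext l
    rw [heq α hα l, ← heq α hα j, hαS j hj]
    rfl
end

section
/- Let Δ = conv{ 0, e_1, e_2, e_3, e_4, e_1 + 4e_2 + 7e_3 + 8e_4 + 9e_5 } ⊂ ℝ^5, where e_1, …, e_5 are the standard unit vectors. Then Δ is a lattice simplex of dimension 5 and #(nΔ ∩ ℤ^5) = C(n+5, 5) + 2·C(n+3, 5) + 4·C(n+2, 5) + 2·C(n+1, 5) for every integer n ≥ 1; that is, the h*-polynomial of Δ equals 1 + 2t^2 + 4t^3 + 2t^4. -/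
open scoped Pointwise

/-- The facet inequalities of the simplex. -/
theorem mem_convexHull_simplex_iff (y : Fin 5 → ℝ) :
    y ∈ convexHull ℝ (Set.range fun j => toReal ((![![0, 0, 0, 0, 0], ![1, 0, 0, 0, 0],
      ![0, 1, 0, 0, 0], ![0, 0, 1, 0, 0], ![0, 0, 0, 1, 0], ![1, 4, 7, 8, 9]] :
        Fin 6 → Fin 5 → ℤ) j)) ↔
      0 ≤ y 4 ∧ y 4 ≤ 9 * y 0 ∧ 4 * y 4 ≤ 9 * y 1 ∧ 7 * y 4 ≤ 9 * y 2 ∧ 8 * y 4 ≤ 9 * y 3 ∧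
        9 * (y 0 + y 1 + y 2 + y 3) ≤ 9 + 19 * y 4 := by
  constructor
  · intro hy
    refine convexHull_min (t := {y : Fin 5 → ℝ | 0 ≤ y 4 ∧ y 4 ≤ 9 * y 0 ∧ 4 * y 4 ≤ 9 * y 1 ∧
      7 * y 4 ≤ 9 * y 2 ∧ 8 * y 4 ≤ 9 * y 3 ∧
        9 * (y 0 + y 1 + y 2 + y 3) ≤ 9 + 19 * y 4}) ?_ ?_ hy
    · rintro _ ⟨j, rfl⟩
      fin_cases j <;> (simp [toReal]; try norm_num)
    · rintro x ⟨x0, x1, x2, x3, x4, x5⟩ y ⟨y0, y1, y2, y3, y4, y5⟩ a b ha hb hab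
      simp only [Set.mem_ofPred_eq, Pi.add_apply, Pi.smul_apply, smul_eq_mul]
      obtain rfl : b = 1 - a := by linarith
      refine ⟨by positivity, ?_, ?_, ?_, ?_, ?_⟩
      · linarith [mul_le_mul_of_nonneg_left x1 ha, mul_le_mul_of_nonneg_left y1 hb]
      · linarith [mul_le_mul_of_nonneg_left x2 ha, mul_le_mul_of_nonneg_left y2 hb]
      · linarith [mul_le_mul_of_nonneg_left x3 ha, mul_le_mul_of_nonneg_left y3 hb]
      · linarith [mul_le_mul_of_nonneg_left x4 ha, mul_le_mul_of_nonneg_left y4 hb]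
      · linarith [mul_le_mul_of_nonneg_left x5 ha, mul_le_mul_of_nonneg_left y5 hb]
  · rintro ⟨h0, h1, h2, h3, h4, h5⟩
    refine mem_convexHull_of_exists_fintype
      ![1 - (y 0 + y 1 + y 2 + y 3) + 19 * y 4 / 9, y 0 - y 4 / 9, y 1 - 4 * y 4 / 9,
        y 2 - 7 * y 4 / 9, y 3 - 8 * y 4 / 9, y 4 / 9] _ ?_ ?_ (fun j => Set.mem_range_self j) ?_
    · intro j
      fin_cases j <;> simp <;> linarith
    · simp [Fin.sum_univ_succ]
      ring
    · ext i
      fin_cases i <;> simp [Fin.sum_univ_succ, toReal] <;> ring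

theorem toReal_mem_smul_convexHull_simplex_iff {n : ℕ} (hn : 1 ≤ n) (x : Fin 5 → ℤ) :
    toReal x ∈ (n : ℝ) • convexHull ℝ (Set.range fun j => toReal ((![![0, 0, 0, 0, 0],
      ![1, 0, 0, 0, 0], ![0, 1, 0, 0, 0], ![0, 0, 1, 0, 0], ![0, 0, 0, 1, 0], ![1, 4, 7, 8, 9]] :
        Fin 6 → Fin 5 → ℤ) j)) ↔
      0 ≤ x 4 ∧ x 4 ≤ 9 * x 0 ∧ 4 * x 4 ≤ 9 * x 1 ∧ 7 * x 4 ≤ 9 * x 2 ∧ 8 * x 4 ≤ 9 * x 3 ∧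
        9 * (x 0 + x 1 + x 2 + x 3) ≤ 9 * n + 19 * x 4 := by
  have hpos : (0 : ℝ) < n := by exact_mod_cast hn
  rw [Set.mem_smul_set_iff_inv_smul_mem₀ hpos.ne', mem_convexHull_simplex_iff]
  simp only [Pi.smul_apply, smul_eq_mul, toReal]
  have key (a b : ℝ) (c d : ℤ) (hc : a * n = c) (hd : b * n = d) : a ≤ b ↔ c ≤ d := by
    rw [← mul_le_mul_iff_left₀ hpos, hc, hd, Int.cast_le]
  refine and_congr (key _ _ _ _ (by simp) ?_) <| and_congr (key _ _ _ _ ?_ ?_) <|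
    and_congr (key _ _ _ _ ?_ ?_) <| and_congr (key _ _ _ _ ?_ ?_) <|
    and_congr (key _ _ _ _ ?_ ?_) (key _ _ _ _ ?_ ?_)
  all_goals
    push_cast
    field_simp

/-- The heights of the nine points in the half-open fundamental parallelepiped of the simplex. -/
def boxHeight : Fin 9 → ℕ := ![0, 2, 2, 3, 3, 3, 3, 4, 4]

/-- The lattice point in the cone over the simplex that is the sum of the `r`-th point in the
fundamental parallelepiped and the combination of the generators with coefficients `a`. -/
def conePoint (p : Σ _ : Fin 9, Fin 6 →₀ ℕ) : Fin 5 → ℤ :=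
  ![p.2 5 + (p.1 + 8 : ℕ) / 9 + p.2 1, 4 * p.2 5 + (4 * p.1 + 8 : ℕ) / 9 + p.2 2,
    7 * p.2 5 + (7 * p.1 + 8 : ℕ) / 9 + p.2 3, 8 * p.2 5 + (8 * p.1 + 8 : ℕ) / 9 + p.2 4,
    9 * p.2 5 + p.1]

/-- The index set for the lattice points in the `n`-th dilation of the simplex. -/
def coneIndex (n : ℕ) : Finset (Σ _ : Fin 9, Fin 6 →₀ ℕ) :=
  Finset.univ.sigma fun r =>
    if boxHeight r ≤ n then Finset.univ.finsuppAntidiag (n - boxHeight r) else ∅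

theorem mem_coneIndex {n : ℕ} {p : Σ _ : Fin 9, Fin 6 →₀ ℕ} :
    p ∈ coneIndex n ↔
      boxHeight p.1 + (p.2 0 + p.2 1 + p.2 2 + p.2 3 + p.2 4 + p.2 5) = n := by
  rw [coneIndex, Finset.mem_sigma]
  split_ifs with h
  · simp [Fin.sum_univ_six]
    omega
  · simp
    omega

theorem card_coneIndex (n : ℕ) :
    (coneIndex n).card = Nat.choose (n + 5) 5 + 2 * Nat.choose (n + 3) 5 +
      4 * Nat.choose (n + 2) 5 + 2 * Nat.choose (n + 1) 5 := by
  have key (h : ℕ) (hh : h ≤ 5) :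
      (if h ≤ n then (Finset.univ : Finset (Fin 6)).finsuppAntidiag (n - h) else ∅).card =
        Nat.choose (n + 5 - h) 5 := by
    split_ifs with hn
    · rw [Finset.card_finsuppAntidiag_nat_eq_choose, Finset.card_univ, Fintype.card_fin,
        show 6 + (n - h) - 1 = n - h + 5 by omega, Nat.choose_symm_add,
        show n - h + 5 = n + 5 - h by omega]
    · rw [Finset.card_empty, Nat.choose_eq_zero_of_lt (by omega)]
  have hle (r : Fin 9) : boxHeight r ≤ 5 := by fin_cases r <;> simp [boxHeight]
  rw [coneIndex, Finset.card_sigma]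
  simp_rw [key _ (hle _)]
  simp [Fin.sum_univ_succ, boxHeight]
  ring

theorem conePoint_injOn (n : ℕ) : Set.InjOn conePoint (coneIndex n) := by
  rintro ⟨r, a⟩ ha ⟨s, b⟩ hb hab
  rw [Finset.mem_coe, mem_coneIndex] at ha hb
  have h0 := congrFun hab 0
  have h1 := congrFun hab 1
  have h2 := congrFun hab 2
  have h3 := congrFun hab 3
  have h4 := congrFun hab 4
  simp [conePoint] at h0 h1 h2 h3 h4
  obtain rfl : r = s := by
    apply Fin.ext
    omega
  congr 1
  ext i
  fin_cases i <;> simp at ha hb ⊢ <;> omega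

theorem conePoint_image_coneIndex {n : ℕ} :
    conePoint '' coneIndex n = {x : Fin 5 → ℤ | 0 ≤ x 4 ∧ x 4 ≤ 9 * x 0 ∧ 4 * x 4 ≤ 9 * x 1 ∧
      7 * x 4 ≤ 9 * x 2 ∧ 8 * x 4 ≤ 9 * x 3 ∧
        9 * (x 0 + x 1 + x 2 + x 3) ≤ 9 * n + 19 * x 4} := by
  ext x
  constructor
  · rintro ⟨⟨r, a⟩, ha, rfl⟩
    rw [Finset.mem_coe, mem_coneIndex] at ha
    simp only [Set.mem_ofPred_eq, conePoint]
    fin_cases r <;> simp [boxHeight] at ha ⊢ <;> omega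
  · rintro ⟨h0, h1, h2, h3, h4, h5⟩
    obtain ⟨k, hk⟩ := Int.eq_ofNat_of_zero_le h0
    obtain ⟨q, r, rfl⟩ : ∃ (q : ℕ) (r : Fin 9), k = 9 * q + r :=
      ⟨k / 9, ⟨k % 9, Nat.mod_lt _ (by norm_num)⟩, (Nat.div_add_mod k 9).symm⟩
    refine ⟨⟨r, Finsupp.equivFunOnFinite.symm
      ![(n + 2 * (9 * q + r) + (9 * q + r) / 9 - (x 0 + x 1 + x 2 + x 3)).toNat,
        (x 0 - (q + (r + 8 : ℕ) / 9)).toNat,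
        (x 1 - (4 * q + (4 * r + 8 : ℕ) / 9)).toNat, (x 2 - (7 * q + (7 * r + 8 : ℕ) / 9)).toNat,
        (x 3 - (8 * q + (8 * r + 8 : ℕ) / 9)).toNat, q]⟩, ?_, ?_⟩
    · rw [Finset.mem_coe, mem_coneIndex]
      fin_cases r <;> simp [boxHeight] at hk ⊢ <;> omega
    · ext i
      fin_cases i <;> simp [conePoint] <;> omega

theorem affineIndependent_simplex :
    AffineIndependent ℝ (fun j => toReal ((![![0, 0, 0, 0, 0], ![1, 0, 0, 0, 0],
      ![0, 1, 0, 0, 0], ![0, 0, 1, 0, 0], ![0, 0, 0, 1, 0], ![1, 4, 7, 8, 9]] :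
        Fin 6 → Fin 5 → ℤ) j)) := by
  rw [affineIndependent_iff_of_fintype]
  intro w hw h
  rw [Finset.weightedVSub_eq_linear_combination _ hw] at h
  have h0 := congrFun h 0
  have h1 := congrFun h 1
  have h2 := congrFun h 2
  have h3 := congrFun h 3
  have h4 := congrFun h 4
  simp [Fin.sum_univ_six, toReal] at hw h0 h1 h2 h3 h4
  intro i
  fin_cases i <;> simp <;> linarith

/-- the simplex `conv{0, e₁, e₂, e₃, e₄, e₁ + 4e₂ + 7e₃ + 8e₄ + 9e₅} ⊆ ℝ⁵`
is a lattice simplex of dimension 5 with h*-polynomial `1 + 2t² + 4t³ + 2t⁴`. -/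
theorem stmt14 (v : Fin 6 → Fin 5 → ℤ)
    (hvdef : v = ![![0, 0, 0, 0, 0], ![1, 0, 0, 0, 0], ![0, 1, 0, 0, 0],
      ![0, 0, 1, 0, 0], ![0, 0, 0, 1, 0], ![1, 4, 7, 8, 9]]) :
    AffineIndependent ℝ (fun j => toReal (v j)) ∧
    ∀ n : ℕ, 1 ≤ n →
      latticeCount (convexHull ℝ (Set.range fun j => toReal (v j))) n =
        Nat.choose (n + 5) 5 + 2 * Nat.choose (n + 3) 5 + 4 * Nat.choose (n + 2) 5 +
          2 * Nat.choose (n + 1) 5 := by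
  subst hvdef
  refine ⟨affineIndependent_simplex, fun n hn => ?_⟩
  simp only [latticeCount, toReal_mem_smul_convexHull_simplex_iff hn]
  rw [← conePoint_image_coneIndex, (conePoint_injOn n).ncard_image,
    Set.ncard_coe_finset, card_coneIndex]
end

section
/- (Scott) Let P ⊂ ℝ^2 be a lattice polytope of dimension 2, and set h_1^* = #(P ∩ ℤ^2) − 3 and h_2^* = #(int(P) ∩ ℤ^2), where int(P) denotes the interior of P. Then at least one of the following holds: (1) h_2^* = 0; (2) h_2^* ≤ h_1^* ≤ 3h_2^* + 3; (3) h_1^* = 7 and h_2^* = 1. -/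
open scoped Pointwise

/-- A convex planar set that meets a horizontal line in `l < x < r` and has points on both sides
of this line contains `(x, y)` in its interior. -/
lemma mem_interior_of_row {Q : Set (ℝ × ℝ)} (hQ : Convex ℝ Q) (hne : (interior Q).Nonempty)
    {l r x y : ℝ} (hl : (l, y) ∈ Q) (hr : (r, y) ∈ Q) (hlx : l < x) (hxr : x < r)
    {c d : ℝ × ℝ} (hc : c ∈ Q) (hcy : y < c.2) (hd : d ∈ Q) (hdy : d.2 < y) :
    (x, y) ∈ interior Q := by
  by_contra hx
  obtain ⟨f, hf⟩ := geometric_hahn_banach_open_point hQ.interior isOpen_interior hx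
  have hle : ∀ w ∈ Q, f w ≤ f (x, y) := by
    intro w hw
    have hw' : w ∈ closure (interior Q) := by
      rw [hQ.closure_interior_eq_closure_of_nonempty_interior hne]
      exact subset_closure hw
    have hsub : closure (interior Q) ⊆ {w | f w ≤ f (x, y)} :=
      closure_minimal (fun a ha => (hf a ha).le) (isClosed_le f.continuous continuous_const)
    exact hsub hw'
  have hlin : ∀ w : ℝ × ℝ, f w = w.1 * f (1, 0) + w.2 * f (0, 1) := by
    intro w
    have hw : w = w.1 • ((1 : ℝ), (0 : ℝ)) + w.2 • ((0 : ℝ), (1 : ℝ)) := by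
      ext <;> simp
    conv_lhs => rw [hw]
    rw [map_add, map_smul, map_smul, smul_eq_mul, smul_eq_mul]
  have h1 := hle _ hl
  have h2 := hle _ hr
  have h3 := hle _ hc
  have h4 := hle _ hd
  obtain ⟨a, ha⟩ := hne
  have h5 := hf a ha
  rw [hlin, hlin (x, y)] at h1 h2 h3 h4 h5
  simp only at h1 h2 h3 h4 h5
  have hα : f (1, 0) = 0 := by
    apply le_antisymm
    · by_contra! h
      nlinarith
    · by_contra! h
      nlinarith
  rw [hα] at h1 h2 h3 h4 h5
  have hβ : f (0, 1) = 0 := by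
    apply le_antisymm
    · by_contra! h
      nlinarith
    · by_contra! h
      nlinarith
  rw [hβ] at h5
  simp at h5

/-- The tent function on `[0, p]` with peak value `1` at `e`. -/
noncomputable def tent (p e y : ℕ) : ℝ :=
  if y < e then (y : ℝ) / e else ((p : ℝ) - y) / ((p : ℝ) - e)

lemma sum_range_cast (n : ℕ) : ∑ j ∈ Finset.range n, (j : ℝ) = n * (n - 1) / 2 := by
  induction n with
  | zero => simp
  | succ k ih =>
    rw [Finset.sum_range_succ, ih]
    push_cast
    ring

lemma sum_tent_range (e k : ℕ) : ∑ y ∈ Finset.range (e + k), tent (e + k) e y =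
    (if e = 0 then 0 else ((e : ℝ) - 1) / 2) + (if k = 0 then 0 else ((k : ℝ) + 1) / 2) := by
  rw [Finset.sum_range_add]
  congr 1
  · have h : ∀ y ∈ Finset.range e, tent (e + k) e y = (y : ℝ) / e := by
      intro y hy
      simp [tent, Finset.mem_range.1 hy]
    rw [Finset.sum_congr rfl h, ← Finset.sum_div, sum_range_cast]
    split_ifs with h0
    · simp [h0]
    · have : (e : ℝ) ≠ 0 := by exact_mod_cast h0
      field_simp
  · have h : ∀ y ∈ Finset.range k, tent (e + k) e (e + y) = 1 - (y : ℝ) / k := by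
      intro y hy
      have hk : (k : ℝ) ≠ 0 := by
        have := Finset.mem_range.1 hy
        exact_mod_cast (by omega : k ≠ 0)
      simp only [tent, add_lt_iff_neg_left, not_lt_zero, if_false]
      push_cast
      rw [add_sub_cancel_left]
      field_simp
      ring
    rw [Finset.sum_congr rfl h, Finset.sum_sub_distrib, ← Finset.sum_div, sum_range_cast]
    split_ifs with h0
    · simp [h0]
    · have : (k : ℝ) ≠ 0 := by exact_mod_cast h0
      simp
      field_simp
      ring

lemma sum_tent_interior {n e : ℕ} (he : e ≤ n + 1) :
    (if e = 0 ∨ e = n + 1 then (n : ℝ) / 2 else ((n : ℝ) + 1) / 2) =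
      ∑ j ∈ Finset.range n, tent (n + 1) e (j + 1) := by
  obtain ⟨k, hk⟩ := Nat.exists_eq_add_of_le he
  have h := sum_tent_range e k
  have hn : (n : ℝ) + 1 = e + k := by exact_mod_cast hk
  rw [← hk, Finset.sum_range_succ'] at h
  have h0 : tent (n + 1) e 0 = if e = 0 then 1 else 0 := by
    rcases Nat.eq_zero_or_pos e with h0 | h0
    · subst h0
      have : (n : ℝ) + 1 ≠ 0 := by positivity
      simp [tent, this]
    · simp [tent, h0, h0.ne']
  rw [h0] at h
  by_cases he0 : e = 0
  · have hk0 : k ≠ 0 := by omega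
    simp [he0, hk0] at h ⊢
    subst he0
    push_cast at hn
    linarith
  · by_cases hk0 : k = 0
    · have : e = n + 1 := by omega
      simp [hk0, this] at h ⊢
      linarith
    · have : e ≠ n + 1 := by omega
      simp [he0, hk0, this] at h ⊢
      linarith

/-- The point at height `y` of the triangle `(υ, 0)`, `(τ, p)`, `(x, e)` opposite to the edge
joining the first two vertices. -/
lemma tent_mem {Q : Set (ℝ × ℝ)} (hQ : Convex ℝ Q) {p e y : ℕ} (hy : y < p)
    {υ τ x : ℝ} (hυ : (υ, (0 : ℝ)) ∈ Q) (hτ : (τ, (p : ℝ)) ∈ Q) (hx : (x, (e : ℝ)) ∈ Q) :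
    (υ + (τ - υ) * y / p - (υ + (τ - υ) * e / p - x) * tent p e y, (y : ℝ)) ∈ Q := by
  have hyp : (y : ℝ) < p := by exact_mod_cast hy
  have hp : (0 : ℝ) < p := lt_of_le_of_lt (Nat.cast_nonneg y) hyp
  unfold tent
  split_ifs with h
  · have hye : (y : ℝ) < e := by exact_mod_cast h
    have he : (0 : ℝ) < e := lt_of_le_of_lt (Nat.cast_nonneg y) hye
    have hm := hQ hυ hx (a := 1 - (y : ℝ) / e) (b := (y : ℝ) / e)
      (by rw [sub_nonneg, div_le_one he]; exact hye.le) (by positivity) (by ring)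
    convert hm using 1
    ext
    · simp
      field_simp
      ring
    · simp
      field_simp
  · have hye : (e : ℝ) ≤ y := by exact_mod_cast not_lt.1 h
    have he : (0 : ℝ) < p - e := by linarith
    have hm := hQ hx hτ (a := ((p : ℝ) - y) / (p - e)) (b := ((y : ℝ) - e) / (p - e))
      (div_nonneg (by linarith) he.le) (div_nonneg (by linarith) he.le)
      (by field_simp; ring)
    convert hm using 1
    ext
    · simp
      field_simp
      ring
    · simp
      field_simp
      ring

section Rows

variable {Q : Set (ℝ × ℝ)} {S I : Finset (ℤ × ℤ)} {n : ℕ}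

/-- Lower bound for the number of interior lattice points in terms of row lengths. -/
lemma sum_row_length_le_card_interior (hQ : Convex ℝ Q) (hne : (interior Q).Nonempty)
    (hI : ∀ z : ℤ × ℤ, z ∈ I ↔ ((z.1 : ℝ), (z.2 : ℝ)) ∈ interior Q)
    {c d : ℝ × ℝ} (hc : c ∈ Q) (hcy : c.2 = n + 1) (hd : d ∈ Q) (hdy : d.2 = 0)
    (L : ℕ → ℝ)
    (hL : ∀ j < n, ∃ l : ℝ, (l, ((j + 1 : ℕ) : ℝ)) ∈ Q ∧ (l + L (j + 1), ((j + 1 : ℕ) : ℝ)) ∈ Q) :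
    ∑ j ∈ Finset.range n, (L (j + 1) - 1) ≤ I.card := by
  have hrow : ∀ j ∈ Finset.range n,
      L (j + 1) - 1 ≤ ((I.filter fun z => z.2 = ((j + 1 : ℕ) : ℤ)).card : ℝ) := by
    intro j hj
    have hjn : j < n := Finset.mem_range.1 hj
    obtain ⟨l, hl, hr⟩ := hL j hjn
    set r := l + L (j + 1) with hr_def
    have hsub : (Finset.Ioo ⌊l⌋ ⌈r⌉).image (fun x => (x, ((j + 1 : ℕ) : ℤ))) ⊆
        I.filter fun z => z.2 = ((j + 1 : ℕ) : ℤ) := by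
      intro z hz
      simp only [Finset.mem_image, Finset.mem_Ioo] at hz
      obtain ⟨x, ⟨hx1, hx2⟩, rfl⟩ := hz
      rw [Finset.mem_filter, hI]
      refine ⟨?_, rfl⟩
      have hjn' : (j : ℝ) < n := by exact_mod_cast hjn
      have := mem_interior_of_row hQ hne hl hr (Int.floor_lt.1 hx1) (Int.lt_ceil.1 hx2) hc
        (by rw [hcy]; push_cast; linarith) hd (by rw [hdy]; positivity)
      simpa using this
    have hcard := Finset.card_le_card hsub
    rw [Finset.card_image_of_injective _ (fun a b h => (Prod.ext_iff.1 h).1), Int.card_Ioo]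
      at hcard
    have h1 : ⌈r⌉ - ⌊l⌋ - 1 ≤ ((I.filter fun z => z.2 = ((j + 1 : ℕ) : ℤ)).card : ℤ) := by
      omega
    have h2 : ((⌈r⌉ : ℝ) - ⌊l⌋ - 1) ≤ ((I.filter fun z => z.2 = ((j + 1 : ℕ) : ℤ)).card : ℝ) := by
      exact_mod_cast h1
    have h3 := Int.le_ceil r
    have h4 := Int.floor_le l
    linarith
  refine (Finset.sum_le_sum hrow).trans ?_
  rw [← Nat.cast_sum]
  have hdisj : ∑ j ∈ Finset.range n, (I.filter fun z => z.2 = ((j + 1 : ℕ) : ℤ)).card =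
      ((Finset.range n).biUnion fun j => I.filter fun z => z.2 = ((j + 1 : ℕ) : ℤ)).card := by
    rw [Finset.card_biUnion]
    intro i _ j _ hij
    rw [Function.onFun, Finset.disjoint_left]
    intro z hz hz'
    rw [Finset.mem_filter] at hz hz'
    have := hz.2.symm.trans hz'.2
    omega
  rw [hdisj]
  exact_mod_cast Finset.card_le_card
    (Finset.biUnion_subset.2 fun j _ => Finset.filter_subset _ _)

/-- Upper bound for the number of non-interior lattice points. -/
lemma card_le_card_interior_add (hQ : Convex ℝ Q) (hne : (interior Q).Nonempty)
    (hS : ∀ z : ℤ × ℤ, z ∈ S ↔ ((z.1 : ℝ), (z.2 : ℝ)) ∈ Q)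
    (hI : ∀ z : ℤ × ℤ, z ∈ I ↔ ((z.1 : ℝ), (z.2 : ℝ)) ∈ interior Q)
    (hbox : ∀ z ∈ S, 0 ≤ z.2 ∧ z.2 ≤ n + 1)
    {c d : ℝ × ℝ} (hc : c ∈ Q) (hcy : c.2 = n + 1) (hd : d ∈ Q) (hdy : d.2 = 0)
    {t t' u u' : ℤ} (htt : t ≤ t') (huu : u ≤ u')
    (ht : ∀ z ∈ S, z.2 = n + 1 → t ≤ z.1 ∧ z.1 ≤ t')
    (hu : ∀ z ∈ S, z.2 = 0 → u ≤ z.1 ∧ z.1 ≤ u') :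
    (S.card : ℤ) ≤ I.card + (t' - t) + (u' - u) + 2 * (n + 1) := by
  classical
  have hIS : I ⊆ S := fun z hz => (hS z).2 (interior_subset ((hI z).1 hz))
  set B := S \ I with hB
  have hcardB : B.card + I.card = S.card := Finset.card_sdiff_add_card_eq_card hIS
  have hfib : B.card = ∑ y ∈ Finset.range (n + 1 + 1), (B.filter fun z => z.2.toNat = y).card := by
    apply Finset.card_eq_sum_card_fiberwise
    intro z hz
    have := hbox z (Finset.mem_sdiff.1 hz).1
    simp only [Finset.coe_range, Set.mem_Iio]
    omega
  rw [Finset.sum_range_succ, Finset.sum_range_succ'] at hfib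
  have hmid : ∀ j ∈ Finset.range n, (B.filter fun z => z.2.toNat = j + 1).card ≤ 2 := by
    intro j hj
    have hjn : j < n := Finset.mem_range.1 hj
    by_contra! h3
    set R := B.filter fun z => z.2.toNat = j + 1 with hR
    have hRy : ∀ z ∈ R, z.2 = (j : ℤ) + 1 := by
      intro z hz
      have := (Finset.mem_filter.1 hz).2
      omega
    have hRS : ∀ z ∈ R, z ∈ S ∧ z ∉ I := fun z hz =>
      Finset.mem_sdiff.1 (Finset.mem_filter.1 hz).1
    have hRne : R.Nonempty := Finset.card_pos.1 (by omega)
    obtain ⟨a, haR, ha⟩ := Finset.exists_min_image R (fun z => z.1) hRne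
    obtain ⟨b, hbR, hb⟩ := Finset.exists_max_image R (fun z => z.1) hRne
    have : ∃ m ∈ R, m ≠ a ∧ m ≠ b := by
      by_contra! hcon
      have : R ⊆ {a, b} := by
        intro m hm
        by_cases hma : m = a
        · simp [hma]
        · simp [hcon m hm hma]
      have := (Finset.card_le_card this).trans Finset.card_le_two
      omega
    obtain ⟨m, hmR, hma, hmb⟩ := this
    have ham : a.1 < m.1 := by
      refine lt_of_le_of_ne (ha m hmR) fun h => hma (Prod.ext h.symm ?_)
      rw [hRy m hmR, hRy a haR]
    have hmb' : m.1 < b.1 := by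
      refine lt_of_le_of_ne (hb m hmR) fun h => hmb (Prod.ext h ?_)
      rw [hRy m hmR, hRy b hbR]
    apply (hRS m hmR).2
    rw [hI]
    have hl := (hS a).1 (hRS a haR).1
    have hr := (hS b).1 (hRS b hbR).1
    rw [hRy a haR] at hl
    rw [hRy b hbR] at hr
    rw [hRy m hmR]
    have hjn' : (j : ℝ) < n := by exact_mod_cast hjn
    exact mem_interior_of_row hQ hne hl hr (by exact_mod_cast ham) (by exact_mod_cast hmb') hc
      (by rw [hcy]; push_cast; linarith) hd (by rw [hdy]; push_cast; positivity)
  have hmid' := Finset.sum_le_sum hmid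
  rw [Finset.sum_const, Finset.card_range, smul_eq_mul] at hmid'
  have hend : ∀ (y : ℕ) (a b : ℤ), a ≤ b → (∀ z ∈ S, z.2 = y → a ≤ z.1 ∧ z.1 ≤ b) →
      ((B.filter fun z => z.2.toNat = y).card : ℤ) ≤ b - a + 1 := by
    intro y a b hab h
    have hsub : B.filter (fun z => z.2.toNat = y) ⊆
        (Finset.Icc a b).image (fun x => (x, (y : ℤ))) := by
      intro z hz
      obtain ⟨hzB, hzy⟩ := Finset.mem_filter.1 hz
      have hzS := (Finset.mem_sdiff.1 hzB).1
      have hz2 : z.2 = y := by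
        have := hbox z hzS
        omega
      simp only [Finset.mem_image, Finset.mem_Icc]
      exact ⟨z.1, h z hzS hz2, Prod.ext rfl hz2.symm⟩
    have := (Finset.card_le_card hsub).trans Finset.card_image_le
    rw [Int.card_Icc] at this
    omega
  have htop := hend (n + 1) t t' htt (by exact_mod_cast ht)
  have hbot := hend 0 u u' huu (by exact_mod_cast hu)
  omega

/-- Modulo `p`, two integer intervals of total length at most `p` come within distance
`(p - s) / 2` of each other, where `s` is their total length. -/
lemma exists_close_shift {t t' u u' p : ℤ} (htt : t ≤ t') (huu : u ≤ u') (hp : 0 < p)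
    (hs : (t' - t) + (u' - u) ≤ p) :
    ∃ τ υ k : ℤ, t ≤ τ ∧ τ ≤ t' ∧ u ≤ υ ∧ υ ≤ u' ∧
      2 * |τ - υ + k * p| ≤ p - ((t' - t) + (u' - u)) := by
  obtain ⟨m, r, hr0, hrp, hD⟩ : ∃ m r : ℤ, 0 ≤ r ∧ r < p ∧ t - u' = r + p * m :=
    ⟨(t - u') / p, (t - u') % p, Int.emod_nonneg _ hp.ne', Int.emod_lt_of_pos _ hp,
      (Int.emod_add_mul_ediv _ _).symm⟩
  by_cases h0 : p - r ≤ (t' - t) + (u' - u)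
  · by_cases h1 : p - r ≤ t' - t
    · refine ⟨t + (p - r), u', -m - 1, by omega, by omega, by omega, by omega, ?_⟩
      have : t + (p - r) - u' + (-m - 1) * p = 0 := by linear_combination hD
      rw [this, abs_zero]
      omega
    · refine ⟨t', u' - (p - r - (t' - t)), -m - 1, by omega, by omega, by omega, by omega, ?_⟩
      have : t' - (u' - (p - r - (t' - t))) + (-m - 1) * p = 0 := by linear_combination hD
      rw [this, abs_zero]
      omega
  · by_cases h1 : 2 * r ≤ p - ((t' - t) + (u' - u))
    · refine ⟨t, u', -m, by omega, by omega, by omega, by omega, ?_⟩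
      have : t - u' + -m * p = r := by linear_combination hD
      rw [this, abs_of_nonneg hr0]
      exact h1
    · refine ⟨t', u, -m - 1, by omega, by omega, by omega, by omega, ?_⟩
      have : t' - u + (-m - 1) * p = -(p - r - ((t' - t) + (u' - u))) := by
        linear_combination hD
      rw [this, abs_neg, abs_of_nonneg (by omega)]
      omega

end Rows

/-- Scott's inequality for a convex set whose lattice width is attained vertically, written in
terms of its lattice points `S` and interior lattice points `I`. -/
theorem scott_of_width {Q : Set (ℝ × ℝ)} {S I : Finset (ℤ × ℤ)} {n : ℕ}
    (hQ : Convex ℝ Q) (hn : n ≠ 0)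
    (hS : ∀ z : ℤ × ℤ, z ∈ S ↔ ((z.1 : ℝ), (z.2 : ℝ)) ∈ Q)
    (hI : ∀ z : ℤ × ℤ, z ∈ I ↔ ((z.1 : ℝ), (z.2 : ℝ)) ∈ interior Q)
    (hIne : I.Nonempty)
    (hbox : ∀ z ∈ S, 0 ≤ z.2 ∧ z.2 ≤ n + 1)
    (hbot : ∃ z ∈ S, z.2 = 0) (htop : ∃ z ∈ S, z.2 = n + 1)
    (hmin : ∀ k a b : ℤ, (∀ z ∈ S, a ≤ z.1 + k * z.2 ∧ z.1 + k * z.2 ≤ b) → n + 1 ≤ b - a) :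
    S.card ≤ 3 * I.card + 6 ∨ S.card = 10 ∧ I.card = 1 := by
  have hIcard : 1 ≤ I.card := hIne.card_pos
  have hne : (interior Q).Nonempty := by
    obtain ⟨z, hz⟩ := hIne
    exact ⟨_, (hI z).1 hz⟩
  have hSne : S.Nonempty := ⟨_, hbot.choose_spec.1⟩
  have row : ∀ y : ℤ, (∃ z ∈ S, z.2 = y) → ∃ a b : ℤ, a ≤ b ∧ (a, y) ∈ S ∧ (b, y) ∈ S ∧
      ∀ z ∈ S, z.2 = y → a ≤ z.1 ∧ z.1 ≤ b := by
    rintro y ⟨z, hz, hzy⟩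
    have hR : (S.filter fun z => z.2 = y).Nonempty := ⟨z, Finset.mem_filter.2 ⟨hz, hzy⟩⟩
    obtain ⟨a, ha, hamin⟩ := Finset.exists_min_image _ (fun z => z.1) hR
    obtain ⟨b, hb, hbmax⟩ := Finset.exists_max_image _ (fun z => z.1) hR
    obtain ⟨haS, hay⟩ := Finset.mem_filter.1 ha
    obtain ⟨hbS, hby⟩ := Finset.mem_filter.1 hb
    refine ⟨a.1, b.1, hamin b hb, ?_, ?_, fun w hw hwy => ?_⟩
    · rwa [← hay]
    · rwa [← hby]
    · have := Finset.mem_filter (p := fun z : ℤ × ℤ => z.2 = y).2 ⟨hw, hwy⟩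
      exact ⟨hamin w this, hbmax w this⟩
  obtain ⟨u, u', huu, huS, huS', hu⟩ := row 0 hbot
  obtain ⟨t, t', htt, htS, htS', ht⟩ := row (n + 1) htop
  have huQ := (hS _).1 huS
  have huQ' := (hS _).1 huS'
  have htQ := (hS _).1 htS
  have htQ' := (hS _).1 htS'
  simp only [Int.cast_zero, Int.cast_add, Int.cast_natCast, Int.cast_one] at huQ huQ' htQ htQ'
  have hupper := card_le_card_interior_add hQ hne hS hI hbox htQ rfl huQ rfl htt huu ht hu
  have hlower := sum_row_length_le_card_interior hQ hne hI htQ rfl huQ rfl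
  have hn0 : (0 : ℝ) < n + 1 := by positivity
  obtain ⟨s, hs⟩ : ∃ s : ℤ, s = (t' - t) + (u' - u) := ⟨_, rfl⟩
  have hs' : (s : ℝ) = (t' - t) + (u' - u) := by exact_mod_cast hs
  by_cases htrap : n = 1 ∨ 4 ≤ s
  · left
    have h := hlower (fun y => (u' - u) + ((t' - t) - (u' - u)) * (y : ℝ) / (n + 1)) ?_
    · have hsum : ∑ j ∈ Finset.range n, (((u' - u) + ((t' - t) - (u' - u)) *
          ((j + 1 : ℕ) : ℝ) / (n + 1) - 1 : ℝ)) = n * s / 2 - n := by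
        simp only [Finset.sum_sub_distrib, Finset.sum_add_distrib, Finset.sum_const,
          Finset.card_range, nsmul_eq_mul, Nat.cast_add, Nat.cast_one, ← Finset.sum_div,
          ← Finset.mul_sum, sum_range_cast, hs']
        field_simp
        ring
      rw [hsum] at h
      have h2 : (n : ℤ) * s - 2 * n ≤ 2 * I.card := by
        have : (n : ℝ) * s - 2 * n ≤ 2 * I.card := by linarith
        exact_mod_cast this
      have h3 : 0 ≤ ((n : ℤ) - 1) * (s - 4) := by
        rcases htrap with h1 | h1
        · simp [h1]
        · exact mul_nonneg (by omega) (by omega)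
      have : (S.card : ℤ) ≤ 3 * I.card + 6 := by nlinarith
      exact_mod_cast this
    · intro j hj
      have hjn : (j : ℝ) + 1 < n + 1 := by exact_mod_cast Nat.succ_lt_succ hj
      have hc0 : 0 ≤ ((j + 1 : ℕ) : ℝ) / (n + 1) := by positivity
      have hc1 : 0 ≤ 1 - ((j + 1 : ℕ) : ℝ) / (n + 1) := by
        rw [sub_nonneg, div_le_one hn0]
        push_cast
        exact hjn.le
      refine ⟨u + (t - u) * ((j + 1 : ℕ) : ℝ) / (n + 1), ?_, ?_⟩
      · convert hQ huQ htQ hc1 hc0 (by ring) using 1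
        ext
        · simp
          field_simp
          ring
        · simp
          field_simp
      · convert hQ huQ' htQ' hc1 hc0 (by ring) using 1
        ext
        · simp
          field_simp
          ring
        · simp
          field_simp
  push Not at htrap
  obtain ⟨hn1, hs4⟩ := htrap
  by_cases hn2 : n = 2
  · subst hn2
    push_cast at hupper
    omega
  left
  have hn3 : 3 ≤ n := by omega
  obtain ⟨τ, υ, k, hτ1, hτ2, hυ1, hυ2, hclose⟩ :=
    exists_close_shift (p := n + 1) htt huu (by omega) (by omega)
  rw [← hs] at hclose
  obtain ⟨v, hvS, hvmin⟩ := Finset.exists_min_image S (fun z => z.1 + k * z.2) hSne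
  obtain ⟨w, hwS, hwmax⟩ := Finset.exists_max_image S (fun z => z.1 + k * z.2) hSne
  have hwidth := hmin k _ _ fun z hz => ⟨hvmin z hz, hwmax z hz⟩
  have between : ∀ (a b x y : ℤ), a ≤ x → x ≤ b → (a, y) ∈ S → (b, y) ∈ S → (x, y) ∈ S := by
    intro a b x y hax hxb ha hb
    rw [hS] at ha hb ⊢
    have hax' : (a : ℝ) ≤ x := by exact_mod_cast hax
    have hxb' : (x : ℝ) ≤ b := by exact_mod_cast hxb
    rcases eq_or_lt_of_le (hax'.trans hxb') with hab | hab
    · have : x = a := by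
        have := Int.cast_injective hab
        omega
      rwa [this]
    · have hba : (0 : ℝ) < b - a := by linarith
      have := hQ ha hb (a := ((b : ℝ) - x) / (b - a)) (b := ((x : ℝ) - a) / (b - a))
        (div_nonneg (by linarith) hba.le) (div_nonneg (by linarith) hba.le)
        (by field_simp; ring)
      convert this using 1
      ext
      · simp
        field_simp
        ring
      · simp
        field_simp
        ring
  have hυS := between u u' υ 0 hυ1 hυ2 huS huS'
  have hτS := between t t' τ (n + 1) hτ1 hτ2 htS htS'
  obtain ⟨x, e, hv⟩ : ∃ (x : ℤ) (e : ℕ), v = (x, (e : ℤ)) :=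
    ⟨v.1, v.2.toNat, Prod.ext rfl (Int.toNat_of_nonneg (hbox v hvS).1).symm⟩
  obtain ⟨x', f, hw⟩ : ∃ (x : ℤ) (e : ℕ), w = (x, (e : ℤ)) :=
    ⟨w.1, w.2.toNat, Prod.ext rfl (Int.toNat_of_nonneg (hbox w hwS).1).symm⟩
  subst hv hw
  have hen : e ≤ n + 1 := by
    have : (e : ℤ) ≤ n + 1 := (hbox _ hvS).2
    omega
  have hfn : f ≤ n + 1 := by
    have : (f : ℤ) ≤ n + 1 := (hbox _ hwS).2
    omega
  have hυQ := (hS _).1 hυS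
  have hτQ := (hS _).1 hτS
  have hvQ := (hS _).1 hvS
  have hwQ := (hS _).1 hwS
  simp only [Int.cast_zero, Int.cast_add, Int.cast_natCast, Int.cast_one] at hυQ hτQ hvQ hwQ
  have hτQ' : ((τ : ℝ), ((n + 1 : ℕ) : ℝ)) ∈ Q := by exact_mod_cast hτQ
  obtain ⟨M, hM⟩ : ∃ M : ℝ → ℝ, ∀ y, M y = υ + (τ - υ) * y / ((n + 1 : ℕ) : ℝ) := ⟨_, fun _ => rfl⟩
  obtain ⟨d, hd⟩ : ∃ d : ℝ, d = M e - x := ⟨_, rfl⟩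
  obtain ⟨d', hd'⟩ : ∃ d : ℝ, d = x' - M f := ⟨_, rfl⟩
  have h := hlower (fun y => d * tent (n + 1) e y + d' * tent (n + 1) f y) ?_
  · rw [Finset.sum_sub_distrib, Finset.sum_add_distrib, ← Finset.mul_sum, ← Finset.mul_sum,
      ← sum_tent_interior hen, ← sum_tent_interior hfn] at h
    simp only [Finset.sum_const, Finset.card_range, nsmul_eq_mul, mul_one] at h
    have hloss : ((n : ℝ) + 1) / 2 * d - ((υ - u) / 2 + (τ - t) / 2) ≤
        d * (if e = 0 ∨ e = n + 1 then (n : ℝ) / 2 else ((n : ℝ) + 1) / 2) := by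
      have h1 : (u : ℝ) ≤ υ := by exact_mod_cast hυ1
      have h2 : (t : ℝ) ≤ τ := by exact_mod_cast hτ1
      split_ifs with he
      · rcases he with rfl | rfl
        · have hd0 : d = υ - x := by rw [hd, hM]; simp
          have hx : (u : ℝ) ≤ x := by exact_mod_cast (hu _ hvS rfl).1
          linarith
        · have hd0 : d = τ - x := by rw [hd, hM]; push_cast; field_simp; ring
          have hx : (t : ℝ) ≤ x := by exact_mod_cast (ht _ hvS (by push_cast; rfl)).1
          linarith
      · linarith
    have hloss' : ((n : ℝ) + 1) / 2 * d' - ((u' - υ) / 2 + (t' - τ) / 2) ≤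
        d' * (if f = 0 ∨ f = n + 1 then (n : ℝ) / 2 else ((n : ℝ) + 1) / 2) := by
      have h1 : (υ : ℝ) ≤ u' := by exact_mod_cast hυ2
      have h2 : (τ : ℝ) ≤ t' := by exact_mod_cast hτ2
      split_ifs with he
      · rcases he with rfl | rfl
        · have hd0 : d' = x' - υ := by rw [hd', hM]; simp
          have hx : (x' : ℝ) ≤ u' := by exact_mod_cast (hu _ hwS rfl).2
          linarith
        · have hd0 : d' = x' - τ := by rw [hd', hM]; push_cast; field_simp; ring
          have hx : (x' : ℝ) ≤ t' := by exact_mod_cast (ht _ hwS (by push_cast; rfl)).2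
          linarith
      · linarith
    have hdd : ((n : ℝ) + 1 + s) / 2 ≤ d + d' := by
      have hg : d + d' = ((x' + k * f) - (x + k * e)) +
          (τ - υ + k * (n + 1)) * (((e : ℝ) - f) / (n + 1)) := by
        rw [hd, hd', hM, hM]
        push_cast
        field_simp
        ring
      have hw' : (n : ℝ) + 1 ≤ (x' + k * f) - (x + k * e) := by exact_mod_cast hwidth
      have hclose' : 2 * |(τ : ℝ) - υ + k * (n + 1)| ≤ n + 1 - s := by exact_mod_cast hclose
      have hfrac : |((e : ℝ) - f) / (n + 1)| ≤ 1 := by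
        have h1 : (e : ℝ) ≤ n + 1 := by exact_mod_cast hen
        have h2 : (f : ℝ) ≤ n + 1 := by exact_mod_cast hfn
        have h3 : (0 : ℝ) ≤ e := by positivity
        have h4 : (0 : ℝ) ≤ f := by positivity
        rw [abs_div, abs_of_pos hn0, div_le_one hn0, abs_le]
        constructor <;> linarith
      have hprod : |((τ : ℝ) - υ + k * (n + 1)) * (((e : ℝ) - f) / (n + 1))| ≤
          |(τ : ℝ) - υ + k * (n + 1)| := by
        rw [abs_mul]
        exact mul_le_of_le_one_right (abs_nonneg _) hfrac
      have := neg_abs_le (((τ : ℝ) - υ + k * (n + 1)) * (((e : ℝ) - f) / (n + 1)))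
      linarith
    have hdd' := mul_le_mul_of_nonneg_left hdd hn0.le
    have hupper' : (S.card : ℝ) ≤ I.card + s + 2 * (n + 1) := by
      rw [hs']
      have : (S.card : ℝ) ≤ I.card + (t' - t) + (u' - u) + 2 * (n + 1) := by exact_mod_cast hupper
      linarith
    have hn3' : (3 : ℝ) ≤ n := by exact_mod_cast hn3
    have hs0 : (0 : ℝ) ≤ s := by exact_mod_cast (by omega : 0 ≤ s)
    have : (S.card : ℝ) ≤ 3 * I.card + 6 := by
      nlinarith [sq_nonneg ((n : ℝ) - 3), mul_nonneg hs0 (sub_nonneg.2 hn3')]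
    exact_mod_cast this
  · intro j hj
    have hj' : j + 1 < n + 1 := by omega
    have h1 := tent_mem hQ hj' hυQ hτQ' hvQ
    have h2 := tent_mem hQ hj' hυQ hτQ' hwQ
    rw [← hM, ← hM] at h1 h2
    refine ⟨_, h1, ?_⟩
    convert h2 using 2
    rw [hd, hd']
    ring

/-- The convex hull of a finite planar set has at least three extreme points if its interior is
nonempty. -/
lemma three_le_ncard_extremePoints {P T : Set (Fin 2 → ℝ)} (hT : T.Finite)
    (hP : P = convexHull ℝ T) (hne : (interior P).Nonempty) :
    3 ≤ (P.extremePoints ℝ).ncard := by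
  have hcomp : IsCompact P := hP ▸ hT.isCompact_convexHull ℝ
  have hconv : Convex ℝ P := hP ▸ convex_convexHull ℝ T
  have hEfin : (P.extremePoints ℝ).Finite := by
    rw [hP]
    exact hT.subset extremePoints_convexHull_subset
  have hE := closure_convexHull_extremePoints hcomp hconv
  rw [(hEfin.isCompact_convexHull ℝ).isClosed.closure_eq] at hE
  have hspan : affineSpan ℝ (P.extremePoints ℝ) = ⊤ := by
    rw [← affineSpan_convexHull, hE]
    exact (hconv.interior_nonempty_iff_affineSpan_eq_top).1 hne
  have hvs : vectorSpan ℝ (P.extremePoints ℝ) = ⊤ := by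
    rw [← direction_affineSpan, hspan, AffineSubspace.direction_top]
  by_contra! hlt
  have hpos : 0 < (P.extremePoints ℝ).ncard := by
    rw [Set.ncard_pos hEfin]
    by_contra! h0
    rw [h0, convexHull_empty] at hE
    rw [← hE, interior_empty] at hne
    exact Set.not_nonempty_empty hne
  obtain ⟨m, hm⟩ := Nat.exists_eq_add_of_le' hpos
  have := finrank_vectorSpan_image_finset_le ℝ id hEfin.toFinset (n := m)
    (by rw [← Set.ncard_eq_toFinset_card _ hEfin, hm])
  rw [Finset.image_id, hEfin.coe_toFinset] at this
  rw [hvs, finrank_top, Module.finrank_fin_fun] at this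
  omega

/-- The affine change of coordinates on the real plane given by a matrix of determinant one,
followed by a vertical translation, in the direction from new to old coordinates. -/
def unimodularChart (a b c d e : ℝ) (hdet : a * d - b * c = 1) : ℝ × ℝ ≃ₜ (Fin 2 → ℝ) where
  toFun z := ![d * z.1 - b * (z.2 - e), -c * z.1 + a * (z.2 - e)]
  invFun v := (a * v 0 + b * v 1, c * v 0 + d * v 1 + e)
  left_inv z := by
    ext
    · simp
      linear_combination z.1 * hdet
    · simp
      linear_combination (z.2 - e) * hdet
  right_inv v := by
    ext i
    fin_cases i
    · simp
      linear_combination v 0 * hdet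
    · simp
      linear_combination v 1 * hdet
  continuous_toFun := by
    refine continuous_pi fun i => ?_
    fin_cases i
    · simp only [Fin.zero_eta, Matrix.cons_val_zero]
      fun_prop
    · simp only [Fin.mk_one, Matrix.cons_val_one, Matrix.cons_val_zero]
      fun_prop
  continuous_invFun := by fun_prop

/-- The integral version of `unimodularChart`. -/
def unimodularLatticeChart (a b c d e : ℤ) (hdet : a * d - b * c = 1) :
    ℤ × ℤ ≃ (Fin 2 → ℤ) where
  toFun z := ![d * z.1 - b * (z.2 - e), -c * z.1 + a * (z.2 - e)]
  invFun v := (a * v 0 + b * v 1, c * v 0 + d * v 1 + e)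
  left_inv z := by
    ext
    · simp
      linear_combination z.1 * hdet
    · simp
      linear_combination (z.2 - e) * hdet
  right_inv v := by
    ext i
    fin_cases i
    · simp
      linear_combination v 0 * hdet
    · simp
      linear_combination v 1 * hdet

lemma toReal_injective {d : ℕ} : Function.Injective (toReal (d := d)) := by
  intro x y h
  ext i
  exact Int.cast_injective (congrFun h i)

lemma finite_lattice_points {d : ℕ} {P : Set (Fin d → ℝ)} (hP : Bornology.IsBounded P) :
    {x : Fin d → ℤ | toReal x ∈ P}.Finite := by
  obtain ⟨R, hR⟩ := hP.exists_norm_le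
  refine (Set.finite_Icc (fun _ => -⌈R⌉) (fun _ => ⌈R⌉)).subset fun x hx => ?_
  have h : ∀ i, |(x i : ℝ)| ≤ ⌈R⌉ := fun i =>
    ((norm_le_pi_norm (toReal x) i).trans (hR _ hx)).trans (Int.le_ceil R)
  have h' : ∀ i, |x i| ≤ ⌈R⌉ := fun i => by exact_mod_cast h i
  exact ⟨fun i => (abs_le.1 (h' i)).1, fun i => (abs_le.1 (h' i)).2⟩

lemma exists_vertical_segment {Q : Set (ℝ × ℝ)} {x y : ℝ} (h : (x, y) ∈ interior Q) :
    ∃ ε > 0, (x, y - ε) ∈ Q ∧ (x, y + ε) ∈ Q := by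
  obtain ⟨ε, hε, hball⟩ := Metric.mem_nhds_iff.1 (mem_interior_iff_mem_nhds.1 h)
  refine ⟨ε / 2, by positivity, hball ?_, hball ?_⟩ <;>
  · rw [Metric.mem_ball, Prod.dist_eq]
    simp [abs_of_pos hε, hε]

lemma card_interior_add_three_le {P : Set (Fin 2 → ℝ)} {V : Finset (Fin 2 → ℤ)}
    (hP : P = convexHull ℝ (toReal '' (V : Set (Fin 2 → ℤ)))) (hne : (interior P).Nonempty)
    (hfin : {x : Fin 2 → ℤ | toReal x ∈ P}.Finite) :
    {x : Fin 2 → ℤ | toReal x ∈ interior P}.ncard + 3 ≤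
      {x : Fin 2 → ℤ | toReal x ∈ P}.ncard := by
  have hE := three_le_ncard_extremePoints (V.finite_toSet.image toReal) hP hne
  have hEV : P.extremePoints ℝ ⊆ Set.range toReal := by
    rw [hP]
    exact extremePoints_convexHull_subset.trans (Set.image_subset_range _ _)
  have hEcard : {x : Fin 2 → ℤ | toReal x ∈ P.extremePoints ℝ}.ncard =
      (P.extremePoints ℝ).ncard :=
    Set.ncard_preimage_of_injective_subset_range toReal_injective hEV
  have hIsub : {x : Fin 2 → ℤ | toReal x ∈ interior P} ⊆ {x | toReal x ∈ P} :=
    fun _ hx => interior_subset (s := P) hx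
  have hEsub : {x : Fin 2 → ℤ | toReal x ∈ P.extremePoints ℝ} ⊆ {x | toReal x ∈ P} :=
    fun _ hx => extremePoints_subset (A := P) hx
  have hdisj : Disjoint {x : Fin 2 → ℤ | toReal x ∈ interior P}
      {x : Fin 2 → ℤ | toReal x ∈ P.extremePoints ℝ} :=
    (disjoint_interior_extremePoints P).preimage toReal
  have hunion := Set.ncard_union_eq hdisj (hfin.subset hIsub) (hfin.subset hEsub)
  have hle := Set.ncard_le_ncard (Set.union_subset hIsub hEsub) hfin
  omega

/-- Scott's inequality in terms of the numbers of lattice points and interior lattice points. -/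
theorem scott_card {P : Set (Fin 2 → ℝ)} {V : Finset (Fin 2 → ℤ)}
    (hP : P = convexHull ℝ (toReal '' (V : Set (Fin 2 → ℤ))))
    (hfin : {x : Fin 2 → ℤ | toReal x ∈ P}.Finite)
    (hne : {x : Fin 2 → ℤ | toReal x ∈ interior P}.Nonempty) :
    {x : Fin 2 → ℤ | toReal x ∈ P}.ncard ≤
        3 * {x : Fin 2 → ℤ | toReal x ∈ interior P}.ncard + 6 ∨
      {x : Fin 2 → ℤ | toReal x ∈ P}.ncard = 10 ∧
        {x : Fin 2 → ℤ | toReal x ∈ interior P}.ncard = 1 := by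
  classical
  set F : Set (Fin 2 → ℤ) := {x | toReal x ∈ P} with hF
  set G : Set (Fin 2 → ℤ) := {x | toReal x ∈ interior P} with hG
  have hGF : G ⊆ F := fun _ hx => interior_subset (s := P) hx
  have hFne : F.Nonempty := hne.mono hGF
  have hconv : Convex ℝ P := hP ▸ convex_convexHull ℝ _
  let W : ℕ → Prop := fun n => ∃ a b c d e : ℤ, a * d - b * c = 1 ∧
    ∀ v ∈ F, 0 ≤ c * v 0 + d * v 1 + e ∧ c * v 0 + d * v 1 + e ≤ n
  have hW : ∃ n, W n := by
    obtain ⟨x, _, hx⟩ := Set.exists_min_image F (fun v => v 1) hfin hFne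
    obtain ⟨y, _, hy⟩ := Set.exists_max_image F (fun v => v 1) hfin hFne
    refine ⟨(y 1 - x 1).toNat, 1, 0, 0, 1, -x 1, by norm_num, fun v hv => ?_⟩
    have h1 := hx v hv
    have h2 := hy v hv
    omega
  obtain ⟨p, hp, hpmin⟩ : ∃ p, W p ∧ ∀ n, W n → p ≤ n :=
    ⟨Nat.find hW, Nat.find_spec hW, fun n hn => Nat.find_min' hW hn⟩
  obtain ⟨a, b, c, d, e, hdet, hbox⟩ := hp
  let ψ := unimodularLatticeChart a b c d e hdet
  let Ψ := unimodularChart a b c d e (by exact_mod_cast hdet)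
  have hψΨ : ∀ z : ℤ × ℤ, toReal (ψ z) = Ψ ((z.1 : ℝ), (z.2 : ℝ)) := by
    intro z
    ext i
    fin_cases i <;> simp [toReal, ψ, Ψ, unimodularLatticeChart, unimodularChart]
  have hψ1 : ∀ v, (ψ.symm v).1 = a * v 0 + b * v 1 := fun v => rfl
  have hψ2 : ∀ v, (ψ.symm v).2 = c * v 0 + d * v 1 + e := fun v => rfl
  have hΨ2 : ∀ v, (Ψ.symm v).2 = c * v 0 + d * v 1 + e := fun v => rfl
  set Q : Set (ℝ × ℝ) := Ψ ⁻¹' P with hQdef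
  have hQ : Convex ℝ Q := by
    intro x hx y hy s t hs ht hst
    have hcomb : Ψ (s • x + t • y) = s • Ψ x + t • Ψ y := by
      ext i
      fin_cases i
      · simp [Ψ, unimodularChart]
        linear_combination (-b * e : ℝ) * hst
      · simp [Ψ, unimodularChart]
        linear_combination (a * e : ℝ) * hst
    rw [hQdef, Set.mem_preimage, hcomb]
    exact hconv hx hy hs ht hst
  let S : Finset (ℤ × ℤ) := hfin.toFinset.map ψ.symm.toEmbedding
  let I : Finset (ℤ × ℤ) := (hfin.subset hGF).toFinset.map ψ.symm.toEmbedding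
  have hScard : S.card = F.ncard := by
    rw [Finset.card_map, Set.ncard_eq_toFinset_card _ hfin]
  have hIcard : I.card = G.ncard := by
    rw [Finset.card_map, Set.ncard_eq_toFinset_card _ (hfin.subset hGF)]
  have hSF : ∀ v, ψ.symm v ∈ S ↔ v ∈ F := by
    intro v
    simp [S]
  have hS : ∀ z : ℤ × ℤ, z ∈ S ↔ ((z.1 : ℝ), (z.2 : ℝ)) ∈ Q := by
    intro z
    rw [← ψ.symm_apply_apply z, hSF, hQdef, Set.mem_preimage, ψ.symm_apply_apply, ← hψΨ]
    rfl
  have hI : ∀ z : ℤ × ℤ, z ∈ I ↔ ((z.1 : ℝ), (z.2 : ℝ)) ∈ interior Q := by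
    intro z
    rw [hQdef, ← Ψ.preimage_interior, Set.mem_preimage, ← hψΨ]
    simp [I, hG]
  have hIne : I.Nonempty := by
    obtain ⟨v, hv⟩ := hne
    exact ⟨ψ.symm v, by simpa [I] using hv⟩
  have hSbox : ∀ z ∈ S, 0 ≤ z.2 ∧ z.2 ≤ p := by
    intro z hz
    have := hbox (ψ z) ((hSF _).1 (by rwa [ψ.symm_apply_apply]))
    rw [← hψ2, ψ.symm_apply_apply] at this
    exact this
  have hPbox : ∀ v ∈ P, 0 ≤ (c * v 0 + d * v 1 + e : ℝ) ∧ (c * v 0 + d * v 1 + e : ℝ) ≤ p := by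
    have hstrip : Convex ℝ {v : Fin 2 → ℝ | 0 ≤ (c * v 0 + d * v 1 + e : ℝ) ∧
        (c * v 0 + d * v 1 + e : ℝ) ≤ p} := by
      rintro x ⟨hx0, hxp⟩ y ⟨hy0, hyp⟩ s t hs ht hst
      have hcomb : (c * (s • x + t • y) 0 + d * (s • x + t • y) 1 + e : ℝ) =
          s * (c * x 0 + d * x 1 + e) + t * (c * y 0 + d * y 1 + e) := by
        simp
        linear_combination (-e : ℝ) * hst
      rw [Set.mem_ofPred_eq, hcomb]
      constructor
      · positivity
      · calc _ ≤ s * (p : ℝ) + t * p := by gcongr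
          _ = p := by rw [← add_mul, hst, one_mul]
    intro v hv
    have hsub : toReal '' (V : Set (Fin 2 → ℤ)) ⊆ {v : Fin 2 → ℝ |
        0 ≤ (c * v 0 + d * v 1 + e : ℝ) ∧ (c * v 0 + d * v 1 + e : ℝ) ≤ p} := by
      rintro _ ⟨w, hw, rfl⟩
      have hwF : w ∈ F := by
        rw [hF, Set.mem_ofPred_eq, hP]
        exact subset_convexHull ℝ _ ⟨w, hw, rfl⟩
      have := hbox w hwF
      simp only [toReal, Set.mem_ofPred_eq]
      exact_mod_cast this
    rw [hP] at hv
    exact convexHull_min hsub hstrip hv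
  have hp2 : 2 ≤ p := by
    obtain ⟨z, hz⟩ := hIne
    obtain ⟨ε, hε, h1, h2⟩ := exists_vertical_segment ((hI z).1 hz)
    have h1' := (hPbox _ h1).1
    have h2' := (hPbox _ h2).2
    rw [← hΨ2, Ψ.symm_apply_apply] at h1' h2'
    simp only at h1' h2'
    have h3 : 0 < z.2 := by
      have : (0 : ℝ) < z.2 := by linarith
      exact_mod_cast this
    have h4 : z.2 < p := by
      have : (z.2 : ℝ) < p := by linarith
      exact_mod_cast this
    omega
  obtain ⟨n, rfl⟩ : ∃ n, p = n + 1 := ⟨p - 1, by omega⟩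
  have hbot : ∃ z ∈ S, z.2 = 0 := by
    by_contra! hcon
    have : W n := ⟨a, b, c, d, e - 1, hdet, fun v hv => by
      have h1 := hbox v hv
      have h2 := hcon _ ((hSF v).2 hv)
      rw [hψ2] at h2
      push_cast at h1
      omega⟩
    have := hpmin n this
    omega
  have htop : ∃ z ∈ S, z.2 = n + 1 := by
    by_contra! hcon
    have : W n := ⟨a, b, c, d, e, hdet, fun v hv => by
      have h1 := hbox v hv
      have h2 := hcon _ ((hSF v).2 hv)
      rw [hψ2] at h2
      push_cast at h1
      omega⟩
    have := hpmin n this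
    omega
  rw [← hScard, ← hIcard]
  refine scott_of_width hQ (by omega : n ≠ 0) hS hI hIne (by exact_mod_cast hSbox) hbot htop ?_
  intro k l r hlr
  obtain ⟨z, hz, _⟩ := hbot
  have hz' := hlr z hz
  have hWlr : W (r - l).toNat := by
    refine ⟨-c, -d, a + k * c, b + k * d, k * e - l, by linear_combination hdet, fun v hv => ?_⟩
    have h := hlr _ ((hSF v).2 hv)
    rw [hψ1, hψ2] at h
    have heq : (a + k * c) * v 0 + (b + k * d) * v 1 + (k * e - l) =
        a * v 0 + b * v 1 + k * (c * v 0 + d * v 1 + e) - l := by ring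
    rw [heq]
    omega
  have := hpmin _ hWlr
  omega

/-- Scott: for a lattice polygon `P ⊆ ℝ²` with `h₁* = #(P ∩ ℤ²) - 3` and
`h₂* = #(int(P) ∩ ℤ²)`, either `h₂* = 0`, or `h₂* ≤ h₁* ≤ 3h₂* + 3`, or `(h₁*, h₂*) = (7, 1)`. -/
theorem stmt16 (P : Set (Fin 2 → ℝ)) (hP : IsFullDimLatticePolytope P)
    (h1 h2 : ℤ)
    (hh1 : h1 = (Set.ncard {x : Fin 2 → ℤ | toReal x ∈ P} : ℤ) - 3)
    (hh2 : h2 = (Set.ncard {x : Fin 2 → ℤ | toReal x ∈ interior P} : ℤ)) :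
    h2 = 0 ∨ (h2 ≤ h1 ∧ h1 ≤ 3 * h2 + 3) ∨ (h1 = 7 ∧ h2 = 1) := by
  obtain ⟨V, hPV, -⟩ := hP
  have hfin : {x : Fin 2 → ℤ | toReal x ∈ P}.Finite := by
    apply finite_lattice_points
    rw [hPV]
    exact ((V.finite_toSet.image toReal).isCompact_convexHull ℝ).isBounded
  by_cases hI : {x : Fin 2 → ℤ | toReal x ∈ interior P}.Nonempty
  · have hne : (interior P).Nonempty := ⟨_, hI.some_mem⟩
    have hlower := card_interior_add_three_le hPV hne hfin
    have hupper := scott_card hPV hfin hI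
    omega
  · left
    rw [hh2, Set.not_nonempty_iff_eq_empty.1 hI, Set.ncard_empty, Nat.cast_zero]
end
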